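/- Let 1 ≤ p ≤ q < ∞, m ∈ ℕ, m' ∈ ℕ₀, a, a' ∈ ℝ and 0 ≤ ℓ < d. Then 𝒦^m_{a,p}(ℝ^d,ℝ^ℓ_*) is continuously embedded into 𝒦^{m'}_{a',q}(ℝ^d,ℝ^ℓ_*) if, and only if, m − d/p ≥ m' − d/q and a − d/p ≥ a' − d/q. -/

import Mathlib

open MeasureTheory Metric Set Filter
open scoped Topology ENNReal NNReal

noncomputable section

/-- `d`-dimensional Euclidean space. -/
abbrev Ed (d : ℕ) : Type := EuclideanSpace ℝ (Fin d)

/-- The finite set of all multi-indices `α : Fin d → ℕ` with `|α| = ∑ i, α i ≤ m`. -/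
def multiIdx (d m : ℕ) : Finset (Fin d → ℕ) :=
  (Fintype.piFinset fun _ : Fin d => Finset.range (m + 1)).filter fun α => ∑ i, α i ≤ m

/-- First-order partial derivative in the `i`-th coordinate direction. -/
def pderivI (d : ℕ) (i : Fin d) (f : Ed d → ℝ) : Ed d → ℝ :=
  fun x => fderiv ℝ f x (EuclideanSpace.single i 1)

/-- Iterated partial derivative `∂^α`. -/
def pderivA (d : ℕ) (α : Fin d → ℕ) (f : Ed d → ℝ) : Ed d → ℝ :=
  ((List.finRange d).foldr (fun i g => (pderivI d i)^[α i] ∘ g) id) f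

/-- Smooth compactly supported test functions with support inside `Ω`. -/
def IsTestFun (d : ℕ) (Ω : Set (Ed d)) (φ : Ed d → ℝ) : Prop :=
  ContDiff ℝ (⊤ : ℕ∞) φ ∧ HasCompactSupport φ ∧ tsupport φ ⊆ Ω

/-- `v` is the `α`-th weak (distributional) derivative of `u` on `Ω`. -/
def HasWeakDerivOn (d : ℕ) (Ω : Set (Ed d)) (α : Fin d → ℕ) (u v : Ed d → ℝ) : Prop :=
  LocallyIntegrableOn u Ω volume ∧ LocallyIntegrableOn v Ω volume ∧
    ∀ φ : Ed d → ℝ, IsTestFun d Ω φ →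
      ∫ x in Ω, u x * pderivA d α φ x = (-1 : ℝ) ^ (∑ i, α i) * ∫ x in Ω, v x * φ x

/-- `D` is a family of weak derivatives of `u` on `Ω` for all multi-indices of order `≤ m`. -/
def IsWeakDerivFamily (d : ℕ) (Ω : Set (Ed d)) (m : ℕ) (u : Ed d → ℝ)
    (D : (Fin d → ℕ) → Ed d → ℝ) : Prop :=
  ∀ α ∈ multiIdx d m, HasWeakDerivOn d Ω α u (D α)

/-- `x ↦ (ρ(x)^(|α|-a) |v(x)|)^p`, the integrand in the Kondratiev norm. -/
def kIntegrand (d : ℕ) (ρ : Ed d → ℝ) (a p : ℝ) (α : Fin d → ℕ) (v : Ed d → ℝ) : Ed d → ℝ :=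
  fun x => (ρ x ^ (((∑ i, α i : ℕ) : ℝ) - a) * |v x|) ^ p

/-- The Kondratiev norm computed from a family `D` of weak derivatives. -/
def KnormP (d : ℕ) (Ω : Set (Ed d)) (ρ : Ed d → ℝ) (m : ℕ) (a p : ℝ)
    (D : (Fin d → ℕ) → Ed d → ℝ) : ℝ :=
  (∑ α ∈ multiIdx d m, ∫ x in Ω, kIntegrand d ρ a p α (D α) x) ^ (1 / p)

/-- `D` witnesses membership of `u` in the Kondratiev space `𝒦^m_{a,p}(Ω, M)`
    (with weight function `ρ`). -/
def KMemData (d : ℕ) (Ω : Set (Ed d)) (ρ : Ed d → ℝ) (m : ℕ) (a p : ℝ)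
    (u : Ed d → ℝ) (D : (Fin d → ℕ) → Ed d → ℝ) : Prop :=
  IsWeakDerivFamily d Ω m u D ∧
    ∀ α ∈ multiIdx d m, IntegrableOn (kIntegrand d ρ a p α (D α)) Ω volume

/-- Membership in the Kondratiev space `𝒦^m_{a,p}(Ω, M)` with weight `ρ`, `p < ∞`. -/
def MemK (d : ℕ) (Ω : Set (Ed d)) (ρ : Ed d → ℝ) (m : ℕ) (a p : ℝ) (u : Ed d → ℝ) : Prop :=
  ∃ D, KMemData d Ω ρ m a p u D

open Classical in
/-- The Kondratiev norm of `u` (computed from a choice of weak derivative family;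
    it is a.e. independent of this choice). -/
def Knorm (d : ℕ) (Ω : Set (Ed d)) (ρ : Ed d → ℝ) (m : ℕ) (a p : ℝ) (u : Ed d → ℝ) : ℝ :=
  if h : MemK d Ω ρ m a p u then KnormP d Ω ρ m a p h.choose else 0

/-- `x ↦ ρ(x)^(|α|-a) v(x)`, the function whose `L_∞` norm enters the norm for `p = ∞`. -/
def kIntegrandInf (d : ℕ) (ρ : Ed d → ℝ) (a : ℝ) (α : Fin d → ℕ) (v : Ed d → ℝ) : Ed d → ℝ :=
  fun x => ρ x ^ (((∑ i, α i : ℕ) : ℝ) - a) * v x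

/-- `D` witnesses membership of `u` in `𝒦^m_{a,∞}(Ω, M)`. -/
def KMemDataInf (d : ℕ) (Ω : Set (Ed d)) (ρ : Ed d → ℝ) (m : ℕ) (a : ℝ)
    (u : Ed d → ℝ) (D : (Fin d → ℕ) → Ed d → ℝ) : Prop :=
  IsWeakDerivFamily d Ω m u D ∧
    ∀ α ∈ multiIdx d m,
      eLpNorm (kIntegrandInf d ρ a α (D α)) ⊤ (volume.restrict Ω) < ⊤

/-- Membership in `𝒦^m_{a,∞}(Ω, M)`. -/
def MemKInf (d : ℕ) (Ω : Set (Ed d)) (ρ : Ed d → ℝ) (m : ℕ) (a : ℝ) (u : Ed d → ℝ) : Prop :=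
  ∃ D, KMemDataInf d Ω ρ m a u D

/-- The `𝒦^m_{a,∞}` norm computed from a family `D` of weak derivatives. -/
def KnormInfP (d : ℕ) (Ω : Set (Ed d)) (ρ : Ed d → ℝ) (m : ℕ) (a : ℝ)
    (D : (Fin d → ℕ) → Ed d → ℝ) : ℝ :=
  ∑ α ∈ multiIdx d m, (eLpNorm (kIntegrandInf d ρ a α (D α)) ⊤ (volume.restrict Ω)).toReal

open Classical in
/-- The `𝒦^m_{a,∞}(Ω, M)` norm of `u`. -/
def KnormInf (d : ℕ) (Ω : Set (Ed d)) (ρ : Ed d → ℝ) (m : ℕ) (a : ℝ) (u : Ed d → ℝ) : ℝ :=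
  if h : MemKInf d Ω ρ m a u then KnormInfP d Ω ρ m a h.choose else 0

/-- The subspace `ℝ^ℓ_* = {x : x₁ = ⋯ = x_{d-ℓ} = 0}` of `ℝ^d`. -/
def RStar (d ℓ : ℕ) : Set (Ed d) := {x | ∀ i : Fin d, (i : ℕ) < d - ℓ → x i = 0}

/-- The weight `ρ(x) = min(1, |x'|)` for the model case `(ℝ^d, ℝ^ℓ_*)`. -/
def rhoModel (d ℓ : ℕ) (x : Ed d) : ℝ :=
  min 1 (Real.sqrt (∑ i ∈ Finset.univ.filter (fun i : Fin d => (i : ℕ) < d - ℓ), (x i) ^ 2))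

/-- The model domain `ℝ^d ∖ ℝ^ℓ_*`. -/
def ModelDomain (d ℓ : ℕ) : Set (Ed d) := (RStar d ℓ)ᶜ

/-- Membership in the model Kondratiev space `𝒦^m_{a,p}(ℝ^d, ℝ^ℓ_*)`, `p < ∞`. -/
def MemKM (d ℓ m : ℕ) (a p : ℝ) (u : Ed d → ℝ) : Prop :=
  MemK d (ModelDomain d ℓ) (rhoModel d ℓ) m a p u

/-- The norm of the model Kondratiev space `𝒦^m_{a,p}(ℝ^d, ℝ^ℓ_*)`, `p < ∞`. -/
def KnormM (d ℓ m : ℕ) (a p : ℝ) (u : Ed d → ℝ) : ℝ :=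
  Knorm d (ModelDomain d ℓ) (rhoModel d ℓ) m a p u

/-- Membership in the model Kondratiev space `𝒦^m_{a,∞}(ℝ^d, ℝ^ℓ_*)`. -/
def MemKMInf (d ℓ m : ℕ) (a : ℝ) (u : Ed d → ℝ) : Prop :=
  MemKInf d (ModelDomain d ℓ) (rhoModel d ℓ) m a u

/-- The norm of the model Kondratiev space `𝒦^m_{a,∞}(ℝ^d, ℝ^ℓ_*)`. -/
def KnormMInf (d ℓ m : ℕ) (a : ℝ) (u : Ed d → ℝ) : ℝ :=
  KnormInf d (ModelDomain d ℓ) (rhoModel d ℓ) m a u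

section

/-- Regularised weight: smooth, positive on the open set `Ω`, and 1-Lipschitz. -/
structure GoodWeight (d : ℕ) (Ω : Set (Ed d)) (σ : Ed d → ℝ) : Prop where
  isOpen : IsOpen Ω
  pos : ∀ x ∈ Ω, 0 < σ x
  smooth : ∀ x ∈ Ω, ContDiffAt ℝ (⊤ : ℕ∞) σ x
  lip : LipschitzWith 1 σ
  nonneg : ∀ x, 0 ≤ σ x
  zero : ∀ x, x ∉ Ω → σ x = 0
  le_one : ∀ x, σ x ≤ 1

/-- Compactly supported `C^1` functions in `Ω`. -/
structure CC1 (d : ℕ) (Ω : Set (Ed d)) (f : Ed d → ℝ) : Prop where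
  c1 : ContDiff ℝ 1 f
  cs : HasCompactSupport f
  sub : tsupport f ⊆ Ω

/-- Pointwise norm. -/
def nrm1 (d : ℕ) (σ : Ed d → ℝ) (f : Ed d → ℝ) (x : Ed d) : ℝ :=
  |f x| + σ x * ‖fderiv ℝ f x‖

variable {d : ℕ} {Ω : Set (Ed d)} {σ : Ed d → ℝ}

lemma contDiff_of_ts {f : Ed d → ℝ} {n : WithTop ℕ∞} (h : ∀ x ∈ tsupport f, ContDiffAt ℝ n f x) :
    ContDiff ℝ n f := by
  rw [contDiff_iff_contDiffAt]
  intro x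
  by_cases hx : x ∈ tsupport f
  · exact h x hx
  · exact (contDiffAt_const (c := (0:ℝ))).congr_of_eventuallyEq
      (notMem_tsupport_iff_eventuallyEq.mp hx)

lemma CC1.eq_zero {f : Ed d → ℝ} (hf : CC1 d Ω f) {x : Ed d} (hx : x ∉ Ω) : f x = 0 :=
  image_eq_zero_of_notMem_tsupport fun h => hx (hf.sub h)

lemma CC1.fderiv_eq_zero {f : Ed d → ℝ} (hf : CC1 d Ω f) {x : Ed d} (hx : x ∉ Ω) :
    fderiv ℝ f x = 0 :=
  image_eq_zero_of_notMem_tsupport fun h => hx (hf.sub (tsupport_fderiv_subset ℝ h))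

lemma GoodWeight.wmul (hσ : GoodWeight d Ω σ) (b : ℝ) {f : Ed d → ℝ} (hf : CC1 d Ω f) :
    CC1 d Ω (fun x => σ x ^ b * f x) := by
  have hs : tsupport (fun x => σ x ^ b * f x) ⊆ tsupport f :=
    closure_mono (Function.support_mul_subset_right _ _)
  refine ⟨contDiff_of_ts fun x hx => ?_, ?_, hs.trans hf.sub⟩
  · have hxΩ := hf.sub (hs hx)
    exact (((hσ.smooth x hxΩ).of_le (by exact_mod_cast le_top)).rpow_const_of_ne
      (hσ.pos x hxΩ).ne').mul hf.c1.contDiffAt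
  · exact hf.cs.mul_left

lemma GoodWeight.fderiv_norm_le (hσ : GoodWeight d Ω σ) (x : Ed d) : ‖fderiv ℝ σ x‖ ≤ 1 := by
  simpa using norm_fderiv_le_of_lipschitz ℝ hσ.lip (x₀ := x)

lemma GoodWeight.fderiv_wmul (hσ : GoodWeight d Ω σ) (b : ℝ) {f : Ed d → ℝ}
    {x : Ed d} (hf : DifferentiableAt ℝ f x) (hx : x ∈ Ω) :
    ‖fderiv ℝ (fun x => σ x ^ b * f x) x‖ ≤ (1 + |b|) * (σ x ^ (b - 1) * nrm1 d σ f x) := by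
  have hp := hσ.pos x hx
  have hd : DifferentiableAt ℝ σ x := (hσ.smooth x hx).differentiableAt (by simp)
  have h1 : HasFDerivAt (fun x => σ x ^ b) ((b * σ x ^ (b - 1)) • fderiv ℝ σ x) x :=
    hd.hasFDerivAt.rpow_const (Or.inl hp.ne')
  have h2 := (h1.mul hf.hasFDerivAt).fderiv
  have h2' : fderiv ℝ (fun x => σ x ^ b * f x) x = σ x ^ b • fderiv ℝ f x + f x • (b * σ x ^ (b - 1)) • fderiv ℝ σ x := h2
  rw [h2']
  have e : σ x ^ b = σ x ^ (b - 1) * σ x := by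
    rw [← Real.rpow_add_one hp.ne']; ring_nf
  have hpp : 0 < σ x ^ (b - 1) := Real.rpow_pos_of_pos hp _
  calc _ ≤ ‖σ x ^ b • fderiv ℝ f x‖ + ‖f x • (b * σ x ^ (b - 1)) • fderiv ℝ σ x‖ := norm_add_le _ _
    _ = σ x ^ (b-1) * (σ x * ‖fderiv ℝ f x‖) + |f x| * |b| * σ x ^ (b-1) * ‖fderiv ℝ σ x‖ := by
        rw [norm_smul, norm_smul, norm_smul, Real.norm_eq_abs, Real.norm_eq_abs, Real.norm_eq_abs,
          abs_mul, abs_of_pos hpp, e, abs_of_pos (by positivity)]; ring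
    _ ≤ σ x ^ (b-1) * (σ x * ‖fderiv ℝ f x‖) + |f x| * |b| * σ x ^ (b-1) * 1 := by
        gcongr; exact hσ.fderiv_norm_le x
    _ ≤ _ := by
        unfold nrm1
        have : 0 ≤ |b| * (σ x ^ (b-1) * (σ x * ‖fderiv ℝ f x‖)) := by positivity
        have : 0 ≤ σ x ^ (b-1) * |f x| := by positivity
        nlinarith

lemma GoodWeight.nrm1_nonneg (hσ : GoodWeight d Ω σ) {f : Ed d → ℝ} (hf : CC1 d Ω f) (x : Ed d) :
    0 ≤ nrm1 d σ f x := by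
  unfold nrm1
  by_cases hx : x ∈ Ω
  · have := hσ.pos x hx; positivity
  · simp [hf.eq_zero hx, hf.fderiv_eq_zero hx]

lemma CC1.nrm1_eq_zero {f : Ed d → ℝ} (hf : CC1 d Ω f) {x : Ed d} (hx : x ∉ Ω) :
    nrm1 d σ f x = 0 := by
  simp [nrm1, hf.eq_zero hx, hf.fderiv_eq_zero hx]

/-- eLpNorm as a lintegral of reals -/
lemma eLpNorm_eq_lint {F : Type*} [NormedAddCommGroup F] (g : Ed d → F) {p : ℝ} (hp : 0 < p) :
    eLpNorm g (ENNReal.ofReal p) volume = (∫⁻ x, ENNReal.ofReal (‖g x‖ ^ p)) ^ (1 / p) := by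
  rw [eLpNorm_eq_lintegral_rpow_enorm_toReal (by simpa using hp) ENNReal.ofReal_ne_top,
    ENNReal.toReal_ofReal hp.le]
  congr 1
  refine lintegral_congr fun x => ?_
  rw [← ofReal_norm, ENNReal.ofReal_rpow_of_nonneg (norm_nonneg _) hp.le]

/-- Weighted GNS inequality, critical exponent. -/
lemma GoodWeight.gns (hσ : GoodWeight d Ω σ) (hd : 0 < d) {p q : ℝ} (hp : 1 ≤ p) (hpd : p < d)
    (hq : 1 / q = 1 / p - 1 / d) :
    ∃ C : ℝ≥0, ∀ f, CC1 d Ω f → ∫⁻ x, ENNReal.ofReal (σ x ^ (-(d:ℝ)) * |f x| ^ q) ≤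
      C * (∫⁻ x, ENNReal.ofReal (σ x ^ (-(d:ℝ)) * nrm1 d σ f x ^ p)) ^ (q / p) := by
  have hd0 : (0:ℝ) < d := by exact_mod_cast hd
  have hp0 : 0 < p := by linarith
  have hq0 : 0 < q := by
    have : 0 < 1 / q := by rw [hq, sub_pos]; exact one_div_lt_one_div_of_lt hp0 hpd
    exact one_div_pos.mp this
  set b : ℝ := 1 - d / p with hb
  have hbq : b * q = -d := by
    have : b = - d * (1 / q) := by rw [hq, hb]; field_simp; ring
    rw [this]; field_simp
  have hbp : (b - 1) * p = -d := by rw [hb]; field_simp; ring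
  set K := SNormLESNormFDerivOfEqConst ℝ (volume : Measure (Ed d)) p
  set K1 : ℝ≥0∞ := K * ENNReal.ofReal (1 + |b|)
  have hK1 : K1 ≠ ⊤ := ENNReal.mul_ne_top ENNReal.coe_ne_top ENNReal.ofReal_ne_top
  refine ⟨(K1 ^ q).toNNReal, fun f hf => ?_⟩
  rw [ENNReal.coe_toNNReal (ENNReal.rpow_ne_top_of_nonneg hq0.le hK1)]
  have hh := hσ.wmul b hf
  have key := eLpNorm_le_eLpNorm_fderiv_of_eq (μ := (volume : Measure (Ed d))) hh.c1 hh.cs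
    (p := p.toNNReal) (p' := q.toNNReal) (by simpa using hp) (by simpa using hd)
    (by rw [NNReal.coe_inv, Real.coe_toNNReal _ hq0.le, Real.coe_toNNReal _ hp0.le]; simpa [one_div] using hq)
  rw [Real.coe_toNNReal _ hp0.le] at key
  change eLpNorm _ (ENNReal.ofReal q) _ ≤ _ * eLpNorm _ (ENNReal.ofReal p) _ at key
  rw [eLpNorm_eq_lint _ hp0, eLpNorm_eq_lint _ hq0] at key
  have e1 : ∫⁻ x, ENNReal.ofReal (‖σ x ^ b * f x‖ ^ q) =
      ∫⁻ x, ENNReal.ofReal (σ x ^ (-(d:ℝ)) * |f x| ^ q) := by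
    refine lintegral_congr fun x => ?_
    congr 1
    by_cases hx : x ∈ Ω
    · have hp := hσ.pos x hx
      rw [norm_mul, Real.mul_rpow (norm_nonneg _) (norm_nonneg _), Real.norm_of_nonneg (by positivity),
        ← Real.rpow_mul hp.le, hbq, Real.norm_eq_abs]
    · simp [hf.eq_zero hx, hq0.ne']
  have e2 : ∫⁻ x, ENNReal.ofReal (‖fderiv ℝ (fun x => σ x ^ b * f x) x‖ ^ p) ≤
      ENNReal.ofReal (1 + |b|) ^ p * ∫⁻ x, ENNReal.ofReal (σ x ^ (-(d:ℝ)) * nrm1 d σ f x ^ p) := by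
    rw [← lintegral_const_mul' _ _ (ENNReal.rpow_ne_top_of_nonneg hp0.le ENNReal.ofReal_ne_top)]
    refine lintegral_mono fun x => ?_
    rw [ENNReal.ofReal_rpow_of_nonneg (by positivity) hp0.le, ← ENNReal.ofReal_mul (by positivity)]
    apply ENNReal.ofReal_le_ofReal
    by_cases hx : x ∈ Ω
    · have hp := hσ.pos x hx
      have hn := hσ.nrm1_nonneg hf x
      calc _ ≤ ((1 + |b|) * (σ x ^ (b - 1) * nrm1 d σ f x)) ^ p := by
            gcongr; exact hσ.fderiv_wmul b (hf.c1.differentiable (by simp) x) hx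
        _ = _ := by
            rw [Real.mul_rpow (by positivity) (by positivity),
              Real.mul_rpow (by positivity) (by positivity), ← Real.rpow_mul hp.le, hbp]
    · rw [hh.fderiv_eq_zero hx, hf.nrm1_eq_zero hx]; simp [hp0.ne']
  rw [e1] at key
  calc _ = ((∫⁻ x, ENNReal.ofReal (σ x ^ (-(d:ℝ)) * |f x| ^ q)) ^ (1 / q)) ^ q := by
        rw [← ENNReal.rpow_mul]; simp [hq0.ne']
    _ ≤ (K * (ENNReal.ofReal (1 + |b|) ^ p * ∫⁻ x, ENNReal.ofReal (σ x ^ (-(d:ℝ)) * nrm1 d σ f x ^ p)) ^ (1 / p)) ^ q := by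
        gcongr; exact key.trans (by gcongr)
    _ = _ := by
        rw [ENNReal.mul_rpow_of_nonneg _ _ (by positivity : 0 ≤ 1 / p), ← ENNReal.rpow_mul,
          mul_one_div_cancel hp0.ne', ENNReal.rpow_one, ← mul_assoc,
          ENNReal.mul_rpow_of_nonneg _ _ hq0.le, ← ENNReal.rpow_mul]
        congr 2
        field_simp
end

section

variable {d : ℕ} {Ω : Set (Ed d)} {σ : Ed d → ℝ}

/-- Weighted Sobolev inequality for `C^1_c` functions. -/
def SobP (d : ℕ) (Ω : Set (Ed d)) (σ : Ed d → ℝ) (p q : ℝ) : Prop :=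
  ∃ C : ℝ≥0, ∀ f, CC1 d Ω f → ∫⁻ x, ENNReal.ofReal (σ x ^ (-(d:ℝ)) * |f x| ^ q) ≤
      C * (∫⁻ x, ENNReal.ofReal (σ x ^ (-(d:ℝ)) * nrm1 d σ f x ^ p)) ^ (q / p)

lemma GoodWeight.sobP_self (hσ : GoodWeight d Ω σ) {p : ℝ} (hp : 1 ≤ p) : SobP d Ω σ p p := by
  refine ⟨1, fun f hf => ?_⟩
  rw [div_self (by linarith), ENNReal.rpow_one, ENNReal.coe_one, one_mul]
  refine lintegral_mono fun x => ENNReal.ofReal_le_ofReal ?_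
  have := hσ.nonneg x
  gcongr
  unfold nrm1
  have : 0 ≤ σ x * ‖fderiv ℝ f x‖ := by positivity
  linarith

lemma interp_pt {p q r t T : ℝ} (hp : 0 < p) (hpq : p ≤ q) (hqr : q ≤ r) (ht : 0 ≤ t) (hT : 0 < T) :
    t ^ q ≤ T ^ (q - p) * t ^ p + T ^ (q - r) * t ^ r := by
  rcases ht.eq_or_lt with rfl | ht
  · rw [Real.zero_rpow (by linarith), Real.zero_rpow (by linarith), Real.zero_rpow (by linarith)]; simp
  have key : ∀ s, T ^ (q - s) * t ^ s = t ^ q * (T / t) ^ (q - s) := by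
    intro s
    rw [Real.div_rpow hT.le ht.le]
    have : t ^ q = t ^ s * t ^ (q - s) := by rw [← Real.rpow_add ht]; ring_nf
    rw [this]; field_simp
  rw [key, key, ← mul_add]
  have h1 : 0 < t ^ q := by positivity
  have hh : 0 < T / t := by positivity
  have : 1 ≤ (T / t) ^ (q - p) + (T / t) ^ (q - r) := by
    rcases le_total 1 (T / t) with h | h
    · have := Real.one_le_rpow h (sub_nonneg.mpr hpq)
      have : 0 < (T / t) ^ (q - r) := by positivity
      linarith
    · have := Real.one_le_rpow_of_pos_of_le_one_of_nonpos hh h (sub_nonpos.mpr hqr)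
      have : 0 < (T / t) ^ (q - p) := by positivity
      linarith
  nlinarith

lemma GoodWeight.meas (hσ : GoodWeight d Ω σ) {f : Ed d → ℝ} (hf : CC1 d Ω f) (b r : ℝ) :
    Measurable fun x => ENNReal.ofReal (σ x ^ b * |f x| ^ r) := by
  have h1 := hσ.lip.continuous.measurable
  have h2 := hf.c1.continuous.measurable
  exact ((h1.pow_const _).mul (h2.abs.pow_const _)).ennreal_ofReal

lemma GoodWeight.meas_nrm1 (hσ : GoodWeight d Ω σ) {f : Ed d → ℝ} (hf : CC1 d Ω f) :
    Measurable (nrm1 d σ f) := by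
  have h1 := hσ.lip.continuous
  have h2 := hf.c1.continuous
  have h3 := hf.c1.continuous_fderiv (by simp)
  unfold nrm1
  exact (by fun_prop : Continuous fun x => |f x| + σ x * ‖fderiv ℝ f x‖).measurable

lemma GoodWeight.sobP_interp (hσ : GoodWeight d Ω σ) {p q r : ℝ} (hp : 1 ≤ p) (hpq : p ≤ q)
    (hqr : q ≤ r) (h : SobP d Ω σ p r) : SobP d Ω σ p q := by
  obtain ⟨C, hC⟩ := h
  have hp0 : 0 < p := by linarith
  have hq0 : 0 < q := by linarith
  have hr0 : 0 < r := by linarith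
  refine ⟨1 + C, fun f hf => ?_⟩
  obtain ⟨C1, hC1⟩ := hσ.sobP_self hp
  have hC := hC f hf
  have hA : ∫⁻ x, ENNReal.ofReal (σ x ^ (-(d:ℝ)) * |f x| ^ p) ≤
      (∫⁻ x, ENNReal.ofReal (σ x ^ (-(d:ℝ)) * nrm1 d σ f x ^ p)) := by
    refine lintegral_mono fun x => ENNReal.ofReal_le_ofReal ?_
    have := hσ.nonneg x
    gcongr
    unfold nrm1
    have : 0 ≤ σ x * ‖fderiv ℝ f x‖ := by positivity
    linarith
  set X := ∫⁻ x, ENNReal.ofReal (σ x ^ (-(d:ℝ)) * nrm1 d σ f x ^ p) with hX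
  have main : ∀ T : ℝ, 0 < T → ∫⁻ x, ENNReal.ofReal (σ x ^ (-(d:ℝ)) * |f x| ^ q) ≤
      ENNReal.ofReal (T ^ (q - p)) * X + ENNReal.ofReal (T ^ (q - r)) * (C * X ^ (r / p)) := by
    intro T hT
    calc _ ≤ ∫⁻ x, (ENNReal.ofReal (T ^ (q - p)) * ENNReal.ofReal (σ x ^ (-(d:ℝ)) * |f x| ^ p) +
          ENNReal.ofReal (T ^ (q - r)) * ENNReal.ofReal (σ x ^ (-(d:ℝ)) * |f x| ^ r)) := by
          refine lintegral_mono fun x => ?_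
          have := hσ.nonneg x
          rw [← ENNReal.ofReal_mul (by positivity), ← ENNReal.ofReal_mul (by positivity),
            ← ENNReal.ofReal_add (by positivity) (by positivity)]
          apply ENNReal.ofReal_le_ofReal
          have h1 := interp_pt hp0 hpq hqr (abs_nonneg (f x)) hT
          have h2 : 0 ≤ σ x ^ (-(d:ℝ)) := by positivity
          nlinarith [mul_le_mul_of_nonneg_left h1 h2]
      _ ≤ _ := by
          rw [lintegral_add_left ((hσ.meas hf _ _).const_mul _), lintegral_const_mul _ (hσ.meas hf _ _),
            lintegral_const_mul _ (hσ.meas hf _ _)]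
          gcongr
  rcases eq_or_ne X ⊤ with hXt | hXt
  · rw [hXt, ENNReal.top_rpow_of_pos (by positivity), ENNReal.mul_top]
    · exact le_top
    · simp
  rcases eq_or_ne X 0 with hX0 | hX0
  · have := main 1 one_pos
    rw [hX0, ENNReal.zero_rpow_of_pos (by positivity)] at this
    rw [hX0, ENNReal.zero_rpow_of_pos (by positivity)]
    simpa using this
  have hT : 0 < X.toReal := ENNReal.toReal_pos hX0 hXt
  have := main (X.toReal ^ (1 / p)) (by positivity)
  refine this.trans (le_of_eq ?_)
  rw [← Real.rpow_mul hT.le, ← Real.rpow_mul hT.le, ← ENNReal.ofReal_rpow_of_pos hT,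
    ← ENNReal.ofReal_rpow_of_pos hT, ENNReal.ofReal_toReal hXt, ENNReal.coe_add, ENNReal.coe_one,
    add_mul, one_mul]
  congr 1
  · nth_rewrite 2 [← ENNReal.rpow_one X]
    rw [← ENNReal.rpow_add _ _ hX0 hXt]
    congr 1; field_simp; ring
  · rw [mul_left_comm, ← ENNReal.rpow_add _ _ hX0 hXt]
    congr 2; field_simp; ring

lemma GoodWeight.sobP_step (hσ : GoodWeight d Ω σ) (hd : 2 ≤ d) {p r : ℝ} (hp : 1 < p) (hpr : p ≤ r)
    (h : SobP d Ω σ p r) : SobP d Ω σ p ((1 + r * (p - 1) / p) * (d / (d - 1))) := by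
  obtain ⟨C, hC⟩ := h
  have hd2 : (2:ℝ) ≤ d := by exact_mod_cast hd
  have hd1 : (0:ℝ) < d - 1 := by linarith
  have hp0 : 0 < p := by linarith
  have hp1 : 0 < p - 1 := by linarith
  have hr0 : 0 < r := by linarith
  set s := 1 + r * (p - 1) / p with hs
  have hs1 : 1 < s := by rw [hs]; have : 0 < r * (p - 1) / p := by positivity
                         linarith
  set q1 : ℝ := d / (d - 1) with hq1
  have hq10 : 0 < q1 := by positivity
  obtain ⟨C1, hC1⟩ := hσ.gns (p := 1) (q := q1) (by omega) le_rfl (by linarith) (by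
    rw [hq1]; field_simp)
  set p' := p / (p - 1) with hp'
  have hp'0 : 0 < p' := by positivity
  have hconj : p'.HolderConjugate p := by
    rw [Real.holderConjugate_iff]
    constructor
    · rw [hp', lt_div_iff₀ hp1]; linarith
    · rw [hp']; field_simp; ring
  have hsp : (s - 1) * p' = r := by rw [hs, hp']; field_simp; ring
  refine ⟨C1 * (s.toNNReal * C ^ (1 / p')) ^ q1, fun f hf => ?_⟩
  have hC := hC f hf
  set X := ∫⁻ x, ENNReal.ofReal (σ x ^ (-(d:ℝ)) * nrm1 d σ f x ^ p) with hX
  have hh : CC1 d Ω (fun x => ‖f x‖ ^ s) := by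
    have hss : tsupport (fun x => ‖f x‖ ^ s) ⊆ tsupport f := by
      refine closure_mono fun x hx => ?_
      contrapose! hx
      simp only [Function.mem_support, not_not] at hx ⊢
      rw [hx, norm_zero, Real.zero_rpow (by linarith)]
    exact ⟨hf.c1.norm_rpow hs1, hf.cs.of_isClosed_subset (isClosed_tsupport _) hss, hss.trans hf.sub⟩
  have h1 := hC1 _ hh
  have hdiff : Differentiable ℝ f := hf.c1.differentiable (by simp)
  have e1 : ∫⁻ x, ENNReal.ofReal (σ x ^ (-(d:ℝ)) * |‖f x‖ ^ s| ^ q1) =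
      ∫⁻ x, ENNReal.ofReal (σ x ^ (-(d:ℝ)) * |f x| ^ (s * q1)) := by
    refine lintegral_congr fun x => ?_
    rw [abs_of_nonneg (by positivity), ← Real.rpow_mul (norm_nonneg _), Real.norm_eq_abs]
  have e2 : ∫⁻ x, ENNReal.ofReal (σ x ^ (-(d:ℝ)) * nrm1 d σ (fun x => ‖f x‖ ^ s) x ^ (1:ℝ)) ≤
      ENNReal.ofReal s * ((∫⁻ x, ENNReal.ofReal (σ x ^ (-(d:ℝ)) * |f x| ^ r)) ^ (1 / p') * X ^ (1 / p)) := by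
    calc _ ≤ ∫⁻ x, ENNReal.ofReal s * (ENNReal.ofReal (σ x ^ (-(d:ℝ) / p') * |f x| ^ (s - 1)) *
          ENNReal.ofReal (σ x ^ (-(d:ℝ) / p) * nrm1 d σ f x)) := by
          refine lintegral_mono fun x => ?_
          have hσ0 := hσ.nonneg x
          rw [← ENNReal.ofReal_mul (by positivity), ← ENNReal.ofReal_mul (by positivity)]
          apply ENNReal.ofReal_le_ofReal
          rw [Real.rpow_one]
          have ew : σ x ^ (-(d:ℝ) / p') * σ x ^ (-(d:ℝ) / p) = σ x ^ (-(d:ℝ)) := by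
            have : -(d:ℝ) = -(d:ℝ) / p' + -(d:ℝ) / p := by rw [hp']; field_simp; ring
            rw [← Real.rpow_add' hσ0 (by rw [← this]; linarith), ← this]
          have hn : nrm1 d σ (fun x => ‖f x‖ ^ s) x ≤ s * (|f x| ^ (s - 1) * nrm1 d σ f x) := by
            have := norm_fderiv_norm_rpow_le hdiff (x := x) hs1
            have hss : |f x| ^ s = |f x| ^ (s - 1) * |f x| := by
              rw [← Real.rpow_add_one' (abs_nonneg _) (by linarith)]; ring_nf
            unfold nrm1
            rw [abs_of_nonneg (by positivity)]
            have h3 := mul_le_mul_of_nonneg_left this hσ0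
            rw [Real.norm_eq_abs] at h3
            simp only [Real.norm_eq_abs] at h3 ⊢
            have h4 : 0 ≤ |f x| ^ (s - 1) * |f x| := by positivity
            rw [hss]
            nlinarith
          have h5 : 0 ≤ σ x ^ (-(d:ℝ)) := by positivity
          calc _ ≤ σ x ^ (-(d:ℝ)) * (s * (|f x| ^ (s - 1) * nrm1 d σ f x)) := by gcongr
            _ = _ := by rw [← ew]; ring
      _ = ENNReal.ofReal s * ∫⁻ x, (ENNReal.ofReal (σ x ^ (-(d:ℝ) / p') * |f x| ^ (s - 1)) *
          ENNReal.ofReal (σ x ^ (-(d:ℝ) / p) * nrm1 d σ f x)) :=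
          lintegral_const_mul' _ _ ENNReal.ofReal_ne_top
      _ ≤ _ := by
          gcongr
          refine (ENNReal.lintegral_mul_le_Lp_mul_Lq volume hconj (hσ.meas hf _ _).aemeasurable
            (((hσ.lip.continuous.measurable.pow_const _).mul (hσ.meas_nrm1 hf)).ennreal_ofReal).aemeasurable).trans
            (le_of_eq ?_)
          congr 2
          · refine lintegral_congr fun x => ?_
            have hσ0 := hσ.nonneg x
            rw [ENNReal.ofReal_rpow_of_nonneg (by positivity) hp'0.le,
              Real.mul_rpow (by positivity) (by positivity), ← Real.rpow_mul hσ0,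
              ← Real.rpow_mul (abs_nonneg _), hsp, div_mul_cancel₀ _ hp'0.ne']
          · refine lintegral_congr fun x => ?_
            have hσ0 := hσ.nonneg x
            have hn := hσ.nrm1_nonneg hf x
            simp only [Pi.mul_apply]
            rw [ENNReal.ofReal_rpow_of_nonneg (by positivity) hp0.le,
              Real.mul_rpow (by positivity) (by positivity), ← Real.rpow_mul hσ0, div_mul_cancel₀ _ hp0.ne']
  rw [e1] at h1
  calc _ ≤ C1 * (ENNReal.ofReal s * ((C * X ^ (r / p)) ^ (1 / p') * X ^ (1 / p))) ^ (q1 / 1) := by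
        refine h1.trans ?_
        gcongr
        refine e2.trans ?_
        gcongr
    _ = _ := by
        rw [div_one, ENNReal.mul_rpow_of_nonneg _ _ (by positivity : 0 ≤ 1 / p'), mul_assoc,
          ← ENNReal.rpow_mul, ← ENNReal.rpow_add_of_nonneg _ _ (by positivity) (by positivity), ← mul_assoc,
          ENNReal.mul_rpow_of_nonneg _ _ hq10.le, ← ENNReal.rpow_mul, ← mul_assoc]
        have e : (r / p * (1 / p') + 1 / p) * q1 = s * q1 / p := by
          rw [hs, hp']; field_simp; ring
        rw [e]
        congr 1
        rw [ENNReal.coe_mul, ENNReal.coe_rpow_of_nonneg _ hq10.le, ENNReal.coe_mul,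
          ENNReal.coe_rpow_of_nonneg _ (by positivity)]
        rfl

lemma GoodWeight.sobP_large (hσ : GoodWeight d Ω σ) (hd : 2 ≤ d) {p : ℝ} (hp : (d:ℝ) ≤ p) (n : ℕ) :
    ∃ r : ℝ, p + n ≤ r ∧ SobP d Ω σ p r := by
  have hd2 : (2:ℝ) ≤ d := by exact_mod_cast hd
  have hd1 : (0:ℝ) < d - 1 := by linarith
  induction n with
  | zero => exact ⟨p, by simp, hσ.sobP_self (by linarith)⟩
  | succ n ih =>
    obtain ⟨r, hr, h⟩ := ih
    have hn : (0:ℝ) ≤ n := by positivity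
    have hp0 : 0 < p := by linarith
    have hr0 : 0 < r := by linarith
    refine ⟨_, ?_, hσ.sobP_step hd (by linarith) (by linarith) h⟩
    have h1 : r + 1 ≤ (1 + r * (p - 1) / p) * (d / (d - 1)) := by
      have e : (d:ℝ) / (d - 1) = 1 + 1 / (d - 1) := by field_simp; ring
      have h2 : (d:ℝ) - 1 ≤ d * ((p - 1) / p) := by
        have : (d:ℝ) * ((p - 1) / p) = d - d / p := by field_simp
        have h3 : (d:ℝ) / p ≤ 1 := by rw [div_le_one hp0]; exact hp
        linarith
      rw [← mul_div_assoc, le_div_iff₀ hd1]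
      have : r * (p - 1) / p * d = r * (d * ((p - 1) / p)) := by ring
      nlinarith [mul_le_mul_of_nonneg_left h2 hr0.le]
    push_cast
    linarith

/-- Core Sobolev inequality for `C^1_c` functions. -/
lemma GoodWeight.sobP (hσ : GoodWeight d Ω σ) (hd : 2 ≤ d) {p q : ℝ} (hp : 1 ≤ p) (hpq : p ≤ q)
    (h : d / p - d / q ≤ 1) : SobP d Ω σ p q := by
  have hd2 : (2:ℝ) ≤ d := by exact_mod_cast hd
  have hp0 : 0 < p := by linarith
  have hq0 : 0 < q := by linarith
  rcases lt_or_ge p d with hpd | hpd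
  · have hpos : 0 < 1 / p - 1 / d := sub_pos.mpr (one_div_lt_one_div_of_lt hp0 hpd)
    refine hσ.sobP_interp hp hpq (r := 1 / (1 / p - 1 / d)) ?_ (hσ.gns (by omega) hp hpd (by simp))
    rw [le_div_iff₀ hpos]
    have : q * (d / p - d / q) ≤ q * 1 := by gcongr
    have e : q * (1 / p - 1 / d) = 1 + (q * (d / p - d / q) - q * 1) / d := by
      field_simp; ring
    rw [e]
    have : (q * (d / p - d / q) - q * 1) / d ≤ 0 := div_nonpos_of_nonpos_of_nonneg (by linarith) (by linarith)
    linarith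
  · obtain ⟨n, hn⟩ := exists_nat_ge q
    obtain ⟨r, hr, h⟩ := hσ.sobP_large hd hpd n
    exact hσ.sobP_interp hp hpq (by linarith) h
end

section

variable {d : ℕ} {Ω : Set (Ed d)} {σ : Ed d → ℝ}

/-- Core Sobolev inequality with weights `a`. -/
lemma GoodWeight.core (hσ : GoodWeight d Ω σ) (hd : 2 ≤ d) {p q : ℝ} (hp : 1 ≤ p) (hpq : p ≤ q)
    (h : d / p - d / q ≤ 1) (a : ℝ) :
    ∃ C : ℝ≥0, ∀ v, CC1 d Ω v →
      ∫⁻ x, ENNReal.ofReal (σ x ^ (-(a - d / p + d / q) * q) * |v x| ^ q) ≤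
      C * (∫⁻ x, ENNReal.ofReal (σ x ^ (-a * p) * nrm1 d σ v x ^ p)) ^ (q / p) := by
  obtain ⟨C, hC⟩ := hσ.sobP hd hp hpq h
  have hp0 : 0 < p := by linarith
  have hq0 : 0 < q := by linarith
  set b : ℝ := d / p - a with hb
  refine ⟨C * ((2 + |b|).toNNReal ^ p) ^ (q / p), fun v hv => ?_⟩
  have hf := hσ.wmul b hv
  have h1 := hC _ hf
  have e1 : ∫⁻ x, ENNReal.ofReal (σ x ^ (-(d:ℝ)) * |σ x ^ b * v x| ^ q) =
      ∫⁻ x, ENNReal.ofReal (σ x ^ (-(a - d / p + d / q) * q) * |v x| ^ q) := by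
    refine lintegral_congr fun x => ?_
    by_cases hx : x ∈ Ω
    · have hp := hσ.pos x hx
      rw [abs_mul, Real.mul_rpow (abs_nonneg _) (abs_nonneg _), abs_of_nonneg (by positivity),
        ← Real.rpow_mul hp.le, ← mul_assoc, ← Real.rpow_add hp]
      congr 3
      rw [hb]; field_simp; ring
    · simp [hv.eq_zero hx, hq0.ne']
  have e2 : ∫⁻ x, ENNReal.ofReal (σ x ^ (-(d:ℝ)) * nrm1 d σ (fun x => σ x ^ b * v x) x ^ p) ≤
      ENNReal.ofReal (2 + |b|) ^ p * ∫⁻ x, ENNReal.ofReal (σ x ^ (-a * p) * nrm1 d σ v x ^ p) := by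
    rw [← lintegral_const_mul' _ _ (ENNReal.rpow_ne_top_of_nonneg hp0.le ENNReal.ofReal_ne_top)]
    refine lintegral_mono fun x => ?_
    rw [ENNReal.ofReal_rpow_of_nonneg (by positivity) hp0.le, ← ENNReal.ofReal_mul (by positivity)]
    apply ENNReal.ofReal_le_ofReal
    by_cases hx : x ∈ Ω
    · have hs := hσ.pos x hx
      have hn := hσ.nrm1_nonneg hv x
      have hn' := hσ.nrm1_nonneg hf x
      have h3 : nrm1 d σ (fun x => σ x ^ b * v x) x ≤ (2 + |b|) * (σ x ^ b * nrm1 d σ v x) := by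
        have h4 := hσ.fderiv_wmul b (hv.c1.differentiable (by simp) x) hx
        have h5 := mul_le_mul_of_nonneg_left h4 hs.le
        have e : σ x ^ b = σ x * σ x ^ (b - 1) := by
          rw [mul_comm, ← Real.rpow_add_one hs.ne']; ring_nf
        have h6 : |v x| ≤ nrm1 d σ v x := by
          unfold nrm1
          have : 0 ≤ σ x * ‖fderiv ℝ v x‖ := by positivity
          linarith
        have h7 : σ x ^ b * |v x| ≤ σ x ^ b * nrm1 d σ v x := by gcongr
        have h8 : |σ x ^ b * v x| = σ x ^ b * |v x| := by
          rw [abs_mul, abs_of_nonneg (by positivity)]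
        calc nrm1 d σ (fun x => σ x ^ b * v x) x
            = |σ x ^ b * v x| + σ x * ‖fderiv ℝ (fun x => σ x ^ b * v x) x‖ := rfl
          _ ≤ σ x ^ b * nrm1 d σ v x + σ x * ((1 + |b|) * (σ x ^ (b - 1) * nrm1 d σ v x)) := by
              rw [h8]; exact add_le_add h7 h5
          _ = _ := by rw [e]; ring
      calc _ ≤ σ x ^ (-(d:ℝ)) * ((2 + |b|) * (σ x ^ b * nrm1 d σ v x)) ^ p := by gcongr
        _ = _ := by
            rw [Real.mul_rpow (by positivity) (by positivity),
              Real.mul_rpow (by positivity) (by positivity), ← Real.rpow_mul hs.le]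
            have : σ x ^ (-a * p) = σ x ^ (-(d:ℝ)) * σ x ^ (b * p) := by
              rw [← Real.rpow_add hs]; congr 1; rw [hb]; field_simp; ring
            rw [this]; ring
    · rw [hf.nrm1_eq_zero hx, hv.nrm1_eq_zero hx]; simp [hp0.ne']
  rw [e1] at h1
  refine (h1.trans (mul_le_mul_right (ENNReal.rpow_le_rpow e2 (by positivity)) _)).trans (le_of_eq ?_)
  rw [ENNReal.mul_rpow_of_nonneg _ _ (by positivity), ← mul_assoc, ENNReal.coe_mul,
    ENNReal.coe_rpow_of_nonneg _ (by positivity), ENNReal.coe_rpow_of_nonneg _ (by positivity)]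
  rfl

lemma smoothTransition_deriv_bdd : ∃ B : ℝ, 0 ≤ B ∧ ∀ t, ‖fderiv ℝ Real.smoothTransition t‖ ≤ B ∧
    (t < 0 ∨ 1 < t → fderiv ℝ Real.smoothTransition t = 0) := by
  have hz : ∀ t : ℝ, (t < 0 ∨ 1 < t → fderiv ℝ Real.smoothTransition t = 0) := by
    rintro t (ht | ht)
    · have : Real.smoothTransition =ᶠ[𝓝 t] fun _ => (0:ℝ) := by
        filter_upwards [Iio_mem_nhds ht] with s hs using Real.smoothTransition.zero_of_nonpos (le_of_lt hs)
      rw [this.fderiv_eq]; simp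
    · have : Real.smoothTransition =ᶠ[𝓝 t] fun _ => (1:ℝ) := by
        filter_upwards [Ioi_mem_nhds ht] with s hs using Real.smoothTransition.one_of_one_le (le_of_lt hs)
      rw [this.fderiv_eq]; simp
  have hc : Continuous (fderiv ℝ Real.smoothTransition) :=
    (Real.smoothTransition.contDiff (n := 1)).continuous_fderiv (by simp)
  obtain ⟨B, hB⟩ := (isCompact_Icc (a := (0:ℝ)) (b := 1)).exists_bound_of_continuousOn hc.continuousOn
  refine ⟨max B 0, le_max_right _ _, fun t => ⟨?_, hz t⟩⟩
  by_cases ht : t ∈ Icc (0:ℝ) 1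
  · exact (hB t ht).trans (le_max_left _ _)
  · rw [hz t]
    · simp
    · rw [mem_Icc, not_and_or, not_le, not_le] at ht; exact ht

/-- Cutoff functions. -/
lemma GoodWeight.cutoff (hσ : GoodWeight d Ω σ) : ∃ (L : ℝ) (χ : ℕ → Ed d → ℝ), 0 ≤ L ∧
    (∀ n, ContDiff ℝ (⊤ : ℕ∞) (χ n) ∧ HasCompactSupport (χ n) ∧ tsupport (χ n) ⊆ Ω ∧
      (∀ x, |χ n x| ≤ 1) ∧ ∀ x, σ x * ‖fderiv ℝ (χ n) x‖ ≤ L) ∧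
    ∀ x ∈ Ω, Tendsto (fun n => χ n x) atTop (𝓝 1) := by
  obtain ⟨B, hB0, hB⟩ := smoothTransition_deriv_bdd
  let β : ContDiffBump (0 : Ed d) := ⟨1, 2, one_pos, one_lt_two⟩
  have hβc : ContDiff ℝ (⊤ : ℕ∞) β := β.contDiff
  obtain ⟨B', hB'⟩ := (β.hasCompactSupport.fderiv (𝕜 := ℝ)).exists_bound_of_continuous
    (hβc.continuous_fderiv (by simp))
  have hB'0 : 0 ≤ B' := (norm_nonneg _).trans (hB' 0)
  let A : ℕ → Ed d → ℝ := fun n x => Real.smoothTransition ((n + 1 : ℝ) * σ x - 1)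
  let Z : ℕ → Ed d → ℝ := fun n x => β (((n + 1 : ℝ)⁻¹) • x)
  have hn : ∀ n : ℕ, (0:ℝ) < n + 1 := fun n => by positivity
  have hA0 : ∀ (n : ℕ) x, σ x ≤ (n + 1 : ℝ)⁻¹ → A n x = 0 := by
    intro n x hx
    apply Real.smoothTransition.zero_of_nonpos
    have := mul_le_mul_of_nonneg_left hx (hn n).le
    rw [mul_inv_cancel₀ (hn n).ne'] at this; linarith
  have hAoff : ∀ n x, x ∉ Ω → A n =ᶠ[𝓝 x] fun _ => 0 := by
    intro n x hx
    have : ∀ᶠ y in 𝓝 x, σ y < (n + 1 : ℝ)⁻¹ := by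
      apply hσ.lip.continuous.continuousAt.eventually_lt continuousAt_const
      rw [hσ.zero x hx]; exact inv_pos.mpr (hn n)
    filter_upwards [this] with y hy using hA0 n y hy.le
  have hAc : ∀ n, ContDiff ℝ (⊤ : ℕ∞) (A n) := by
    intro n
    rw [contDiff_iff_contDiffAt]
    intro x
    by_cases hx : x ∈ Ω
    · exact (Real.smoothTransition.contDiff.contDiffAt).comp x
        ((contDiffAt_const.mul (hσ.smooth x hx)).sub contDiffAt_const)
    · exact contDiffAt_const.congr_of_eventuallyEq (hAoff n x hx)
  have hZc : ∀ n, ContDiff ℝ (⊤ : ℕ∞) (Z n) := fun n => hβc.comp (contDiff_const_smul _)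
  have hsupp : ∀ n, tsupport (fun x => A n x * Z n x) ⊆
      {x | (n + 1 : ℝ)⁻¹ ≤ σ x} ∩ closedBall 0 (2 * (n + 1)) := by
    intro n
    refine closure_minimal ?_ ((isClosed_le continuous_const hσ.lip.continuous).inter isClosed_closedBall)
    intro x hx
    simp only [Function.mem_support, ne_eq, mul_eq_zero, not_or] at hx
    constructor
    · by_contra h
      exact hx.1 (hA0 n x (not_le.mp h).le)
    · by_contra h
      apply hx.2
      apply β.zero_of_le_dist
      rw [mem_closedBall, dist_zero_right, not_le] at h
      rw [dist_zero_right, norm_smul, norm_inv, Real.norm_of_nonneg (hn n).le, inv_mul_eq_div,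
        le_div_iff₀ (hn n)]
      exact h.le
  refine ⟨2 * B + B', fun n x => A n x * Z n x, by positivity, fun n => ⟨(hAc n).mul (hZc n), ?_, ?_, ?_, ?_⟩, ?_⟩
  · exact (isCompact_closedBall (0 : Ed d) (2 * (n + 1))).of_isClosed_subset (isClosed_tsupport _)
      ((hsupp n).trans inter_subset_right)
  · intro x hx
    by_contra h
    have := ((hsupp n) hx).1
    rw [mem_ofPred_eq, hσ.zero x h] at this
    exact absurd (inv_pos.mpr (hn n)) (not_lt.mpr this)
  · intro x
    rw [abs_mul]
    have h1 : |A n x| ≤ 1 := by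
      rw [abs_of_nonneg (Real.smoothTransition.nonneg _)]; exact Real.smoothTransition.le_one _
    have h2 : |Z n x| ≤ 1 := by
      rw [abs_of_nonneg β.nonneg]; exact β.le_one
    exact mul_le_one₀ h1 (abs_nonneg _) h2
  · intro x
    have hs0 := hσ.nonneg x
    have hs1 := hσ.le_one x
    have h1 : |A n x| ≤ 1 := by
      rw [abs_of_nonneg (Real.smoothTransition.nonneg _)]; exact Real.smoothTransition.le_one _
    have h2 : |Z n x| ≤ 1 := by
      rw [abs_of_nonneg β.nonneg]; exact β.le_one
    have hdA : DifferentiableAt ℝ (A n) x := (hAc n).differentiable (by simp) x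
    have hdZ : DifferentiableAt ℝ (Z n) x := (hZc n).differentiable (by simp) x
    have hA' : σ x * ‖fderiv ℝ (A n) x‖ ≤ 2 * B := by
      by_cases hx : x ∈ Ω
      · have hds : DifferentiableAt ℝ σ x := (hσ.smooth x hx).differentiableAt (by simp)
        have hT : DifferentiableAt ℝ Real.smoothTransition ((n + 1 : ℝ) * σ x - 1) :=
          (Real.smoothTransition.contDiff (n := 1)).differentiable (by simp) _
        have hin : HasFDerivAt (fun y => (n + 1 : ℝ) * σ y - 1) ((n + 1 : ℝ) • fderiv ℝ σ x) x :=
          (hds.hasFDerivAt.const_mul (n + 1 : ℝ)).sub_const 1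
        have e : fderiv ℝ (A n) x = (fderiv ℝ Real.smoothTransition ((n + 1 : ℝ) * σ x - 1)).comp
            ((n + 1 : ℝ) • fderiv ℝ σ x) :=
          (HasFDerivAt.comp x (f := fun y => (n + 1 : ℝ) * σ y - 1) hT.hasFDerivAt hin).fderiv
        by_cases hb : (n + 1 : ℝ) * σ x - 1 ≤ 1
        · rw [e]
          calc σ x * ‖(fderiv ℝ Real.smoothTransition ((n + 1 : ℝ) * σ x - 1)).comp
                ((n + 1 : ℝ) • fderiv ℝ σ x)‖
              ≤ σ x * (B * ((n + 1) * 1)) := by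
                gcongr
                refine (ContinuousLinearMap.opNorm_comp_le _ _).trans ?_
                rw [norm_smul, Real.norm_of_nonneg (hn n).le]
                gcongr
                · exact (hB _).1
                · exact hσ.fderiv_norm_le x
            _ = ((n + 1) * σ x) * B := by ring
            _ ≤ 2 * B := by gcongr; linarith
        · rw [e, (hB _).2 (Or.inr (not_le.mp hb))]; simp; exact hB0
      · rw [(hAoff n x hx).fderiv_eq]; simp; exact hB0
    have hZ' : ‖fderiv ℝ (Z n) x‖ ≤ B' := by
      have e : fderiv ℝ (Z n) x = (n + 1 : ℝ)⁻¹ • fderiv ℝ β ((n + 1 : ℝ)⁻¹ • x) := by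
        have hbd : DifferentiableAt ℝ β ((n + 1 : ℝ)⁻¹ • x) := hβc.differentiable (by simp) _
        have hin : HasFDerivAt (fun y : Ed d => (n + 1 : ℝ)⁻¹ • y) ((n + 1 : ℝ)⁻¹ • ContinuousLinearMap.id ℝ (Ed d)) x :=
          (hasFDerivAt_id (𝕜 := ℝ) x).const_smul ((n + 1 : ℝ)⁻¹)
        have := (HasFDerivAt.comp x (f := fun y : Ed d => (n + 1 : ℝ)⁻¹ • y) hbd.hasFDerivAt hin).fderiv
        refine this.trans ?_
        ext y; simp
      rw [e, norm_smul, norm_inv, Real.norm_of_nonneg (hn n).le]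
      have : (n + 1 : ℝ)⁻¹ ≤ 1 := inv_le_one_of_one_le₀ (by simp)
      calc _ ≤ 1 * B' := by gcongr; exact hB' _
        _ = B' := one_mul _
    have e : fderiv ℝ (fun x => A n x * Z n x) x = A n x • fderiv ℝ (Z n) x + Z n x • fderiv ℝ (A n) x :=
      fderiv_fun_mul hdA hdZ
    rw [e]
    calc _ ≤ σ x * (‖A n x • fderiv ℝ (Z n) x‖ + ‖Z n x • fderiv ℝ (A n) x‖) := by
          gcongr; exact norm_add_le _ _
      _ = σ x * (|A n x| * ‖fderiv ℝ (Z n) x‖) + |Z n x| * (σ x * ‖fderiv ℝ (A n) x‖) := by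
          rw [norm_smul, norm_smul, Real.norm_eq_abs, Real.norm_eq_abs]; ring
      _ ≤ 1 * (1 * B') + 1 * (2 * B) := by gcongr
      _ = _ := by ring
  · intro x hx
    have hs := hσ.pos x hx
    apply tendsto_const_nhds.congr'
    have t1 : Tendsto (fun n : ℕ => (n + 1 : ℝ)) atTop atTop :=
      tendsto_atTop_add_const_right _ _ tendsto_natCast_atTop_atTop
    filter_upwards [t1.eventually_ge_atTop (2 / σ x), t1.eventually_ge_atTop ‖x‖] with n h1 h2
    have e1 : A n x = 1 := by
      apply Real.smoothTransition.one_of_one_le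
      rw [div_le_iff₀ hs] at h1; linarith
    have e2 : Z n x = 1 := by
      apply β.one_of_mem_closedBall
      rw [mem_closedBall, dist_zero_right, norm_smul, norm_inv, Real.norm_of_nonneg (hn n).le,
        inv_mul_eq_div, div_le_iff₀ (hn n)]
      change ‖x‖ ≤ 1 * _
      simpa using h2
    simp [e1, e2]
end

section

variable {d : ℕ} {Ω : Set (Ed d)} {σ : Ed d → ℝ}

/-- Mollification. -/
def moll (d : ℕ) (Ω : Set (Ed d)) (ψ g : Ed d → ℝ) (x : Ed d) : ℝ := ∫ t in Ω, g t * ψ (x - t)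

lemma moll_jensen {ψ g : Ed d → ℝ} (hψ : Continuous ψ) (hψ0 : ∀ x, 0 ≤ ψ x)
    (hψ1 : ∫⁻ x, ENNReal.ofReal (ψ x) = 1) (hg : AEStronglyMeasurable g (volume.restrict Ω))
    {p : ℝ} (hp : 1 ≤ p) (x : Ed d) :
    ENNReal.ofReal (|moll d Ω ψ g x| ^ p) ≤
      ∫⁻ t in Ω, ENNReal.ofReal (ψ (x - t)) * ENNReal.ofReal (|g t| ^ p) := by
  have hp0 : 0 < p := by linarith
  set w : Ed d → ℝ≥0∞ := fun t => ENNReal.ofReal (ψ (x - t)) with hw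
  have hwm : Measurable w := by
    have : Continuous fun t => ψ (x - t) := by fun_prop
    exact this.measurable.ennreal_ofReal
  have hw1 : ∫⁻ t, w t = 1 := by
    rw [← hψ1]; exact lintegral_sub_left_eq_self (fun t => ENNReal.ofReal (ψ t)) x
  set ν := (volume.restrict Ω).withDensity w with hν
  have hν1 : ν univ ≤ 1 := by
    rw [hν, withDensity_apply _ MeasurableSet.univ, Measure.restrict_univ, ← hw1]
    exact setLIntegral_le_lintegral _ _
  have hgν : AEStronglyMeasurable g ν := hg.mono_ac (withDensity_absolutelyContinuous _ _)
  have h1 : ‖moll d Ω ψ g x‖ₑ ≤ ∫⁻ t, ‖g t‖ₑ ∂ν := by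
    rw [hν, lintegral_withDensity_eq_lintegral_mul₀ hwm.aemeasurable hg.enorm]
    refine (enorm_integral_le_lintegral_enorm _).trans (le_of_eq (lintegral_congr fun t => ?_))
    rw [enorm_mul, Pi.mul_apply, mul_comm, hw, Real.enorm_of_nonneg (hψ0 _)]
  have h2 := eLpNorm'_le_eLpNorm'_mul_rpow_measure_univ one_pos hp hgν
  have h3 : ∫⁻ t, ‖g t‖ₑ ∂ν ≤ (∫⁻ t, ‖g t‖ₑ ^ p ∂ν) ^ (1 / p) := by
    have e1 : eLpNorm' g 1 ν = ∫⁻ t, ‖g t‖ₑ ∂ν := by simp [eLpNorm']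
    rw [e1] at h2
    refine h2.trans ?_
    have : ν univ ^ (1 / 1 - 1 / p) ≤ 1 := by
      apply ENNReal.rpow_le_one hν1
      rw [sub_nonneg, div_one, div_le_one hp0]; exact hp
    calc _ ≤ eLpNorm' g p ν * 1 := by gcongr
      _ = _ := by rw [mul_one]; rfl
  calc ENNReal.ofReal (|moll d Ω ψ g x| ^ p) = ‖moll d Ω ψ g x‖ₑ ^ p := by
        rw [Real.enorm_eq_ofReal_abs, ENNReal.ofReal_rpow_of_nonneg (abs_nonneg _) hp0.le]
    _ ≤ ((∫⁻ t, ‖g t‖ₑ ^ p ∂ν) ^ (1 / p)) ^ p := by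
        gcongr; exact h1.trans h3
    _ = ∫⁻ t, ‖g t‖ₑ ^ p ∂ν := by rw [← ENNReal.rpow_mul]; simp [hp0.ne']
    _ = _ := by
        rw [hν, lintegral_withDensity_eq_lintegral_mul₀ hwm.aemeasurable (hg.enorm.pow_const _)]
        refine lintegral_congr fun t => ?_
        rw [Pi.mul_apply, Real.enorm_eq_ofReal_abs, ENNReal.ofReal_rpow_of_nonneg (abs_nonneg _) hp0.le]

lemma rpow_compar {s t : ℝ} (hs : 0 < s) (h1 : s ≤ 2 * t) (h2 : t ≤ 2 * s) (c : ℝ) :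
    s ^ c ≤ 2 ^ |c| * t ^ c := by
  have ht : 0 < t := by linarith
  have e : s ^ c = (s / t) ^ c * t ^ c := by rw [Real.div_rpow hs.le ht.le]; field_simp
  rw [e]
  gcongr
  have hst : 0 < s / t := by positivity
  rcases le_total 0 c with hc | hc
  · rw [abs_of_nonneg hc]
    apply Real.rpow_le_rpow hst.le _ hc
    rw [div_le_iff₀ ht]; exact h1
  · rw [abs_of_nonpos hc]
    have : (s / t) ^ c = (t / s) ^ (-c) := by
      rw [Real.rpow_neg (by positivity), ← Real.inv_rpow (by positivity), inv_div]
    rw [this]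
    apply Real.rpow_le_rpow (by positivity) _ (by linarith)
    rw [div_le_iff₀ hs]; exact h2

lemma GoodWeight.moll_bound (hσ : GoodWeight d Ω σ) {ψ g : Ed d → ℝ} (hψ : Continuous ψ)
    (hψ0 : ∀ x, 0 ≤ ψ x)
    (hψ1 : ∫⁻ x, ENNReal.ofReal (ψ x) = 1) (hg : AEStronglyMeasurable g (volume.restrict Ω))
    {p : ℝ} (hp : 1 ≤ p) (c : ℝ) {δ : ℝ} (hδ : 0 < δ) {K : Set (Ed d)} (hK : IsCompact K)
    (hKδ : ∀ x ∈ K, 2 * δ ≤ σ x) (hψδ : ∀ x, δ ≤ ‖x‖ → ψ x = 0) :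
    ∫⁻ x in K, ENNReal.ofReal (σ x ^ c * |moll d Ω ψ g x| ^ p) ≤
      ENNReal.ofReal (2 ^ |c|) * ∫⁻ t in Ω, ENNReal.ofReal (σ t ^ c * |g t| ^ p) := by
  have hσm := hσ.lip.continuous.measurable
  have hgm : AEMeasurable (fun t => ENNReal.ofReal (|g t| ^ p)) (volume.restrict Ω) :=
    (hg.aemeasurable.abs.pow_const p).ennreal_ofReal
  calc _ ≤ ∫⁻ x in K, ∫⁻ t in Ω, ENNReal.ofReal (ψ (x - t)) * (ENNReal.ofReal (2 ^ |c|) *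
        (ENNReal.ofReal (σ t ^ c) * ENNReal.ofReal (|g t| ^ p))) := by
        refine setLIntegral_mono' hK.measurableSet fun x hx => ?_
        have hsx := hσ.nonneg x
        have hx2 := hKδ x hx
        rw [ENNReal.ofReal_mul (by positivity)]
        refine (mul_le_mul_right (moll_jensen hψ hψ0 hψ1 hg hp x) _).trans ?_
        rw [← lintegral_const_mul' _ _ ENNReal.ofReal_ne_top]
        refine lintegral_mono fun t => ?_
        by_cases ht : ‖x - t‖ < δ
        · have hl := hσ.lip.dist_le_mul x t
          rw [Real.dist_eq, dist_eq_norm, NNReal.coe_one, one_mul] at hl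
          have hl' := abs_le.mp (hl.trans ht.le)
          have hr := rpow_compar (s := σ x) (t := σ t) (by linarith) (by linarith [hl'.1, hl'.2])
            (by linarith [hl'.1, hl'.2]) c
          have hst := hσ.nonneg t
          have hr' : ENNReal.ofReal (σ x ^ c) ≤ ENNReal.ofReal (2 ^ |c|) * ENNReal.ofReal (σ t ^ c) := by
            rw [← ENNReal.ofReal_mul (by positivity)]
            exact ENNReal.ofReal_le_ofReal hr
          calc _ ≤ (ENNReal.ofReal (2 ^ |c|) * ENNReal.ofReal (σ t ^ c)) *
                (ENNReal.ofReal (ψ (x - t)) * ENNReal.ofReal (|g t| ^ p)) := by gcongr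
            _ = _ := by ring
        · rw [hψδ _ (not_lt.mp ht)]; simp
    _ = ∫⁻ t in Ω, ∫⁻ x in K, ENNReal.ofReal (ψ (x - t)) * (ENNReal.ofReal (2 ^ |c|) *
        (ENNReal.ofReal (σ t ^ c) * ENNReal.ofReal (|g t| ^ p))) := by
        apply lintegral_lintegral_swap
        have : Continuous fun z : Ed d × Ed d => ψ (z.1 - z.2) := by fun_prop
        have hm1 : AEMeasurable (fun z : Ed d × Ed d => ENNReal.ofReal (ψ (z.1 - z.2)))
          ((volume.restrict K).prod (volume.restrict Ω)) := this.measurable.ennreal_ofReal.aemeasurable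
        have hm2 := AEMeasurable.comp_snd (μ := volume.restrict K)
          (((hσm.pow_const c).ennreal_ofReal.aemeasurable.mul hgm).const_mul (ENNReal.ofReal (2 ^ |c|)))
        exact hm1.mul hm2
    _ ≤ ∫⁻ t in Ω, 1 * (ENNReal.ofReal (2 ^ |c|) *
        (ENNReal.ofReal (σ t ^ c) * ENNReal.ofReal (|g t| ^ p))) := by
        refine lintegral_mono fun t => ?_
        rw [lintegral_mul_const]
        · gcongr
          refine (setLIntegral_le_lintegral _ _).trans ?_
          rw [lintegral_sub_right_eq_self (fun x => ENNReal.ofReal (ψ x)) t, hψ1]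
        · have : Continuous fun x => ψ (x - t) := by fun_prop
          exact this.measurable.ennreal_ofReal
    _ = _ := by
        rw [← lintegral_const_mul' _ _ ENNReal.ofReal_ne_top]
        refine lintegral_congr fun t => ?_
        rw [one_mul, ENNReal.ofReal_mul (Real.rpow_nonneg (hσ.nonneg t) _)]

/-- Weak gradients. -/
structure WG (d : ℕ) (Ω : Set (Ed d)) (u : Ed d → ℝ) (G : Fin d → Ed d → ℝ) : Prop where
  li : LocallyIntegrableOn u Ω volume
  lg : ∀ i, LocallyIntegrableOn (G i) Ω volume
  ibp : ∀ i φ, IsTestFun d Ω φ →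
    ∫ x in Ω, u x * pderivI d i φ x = - ∫ x in Ω, G i x * φ x

lemma opNorm_le_sum (T : Ed d →L[ℝ] ℝ) : ‖T‖ ≤ ∑ i, |T (EuclideanSpace.single i 1)| := by
  refine T.opNorm_le_bound (by positivity) fun y => ?_
  have e : y = ∑ i, y i • EuclideanSpace.single i (1:ℝ) := by
    ext j; simp [Finset.sum_apply, Pi.single_apply]
  conv_lhs => rw [e]
  rw [map_sum, Finset.sum_mul]
  refine (norm_sum_le _ _).trans (Finset.sum_le_sum fun i _ => ?_)
  rw [map_smul, norm_smul, mul_comm, Real.norm_eq_abs]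
  gcongr
  exact PiLp.norm_apply_le y i

open scoped Convolution in
/-- Mollified function: smoothness and gradient. -/
lemma moll_deriv {u : Ed d → ℝ} {G : Fin d → Ed d → ℝ} (hΩ : IsOpen Ω) (hu : WG d Ω u G) {ψ : Ed d → ℝ}
    (hψ : ContDiff ℝ (⊤ : ℕ∞) ψ) {δ : ℝ} (hψδ : ∀ x, δ ≤ ‖x‖ → ψ x = 0)
    {K : Set (Ed d)} (hK : IsCompact K) (hKΩ : cthickening δ K ⊆ Ω) :
    ∃ w : Ed d → ℝ, ContDiff ℝ (⊤ : ℕ∞) w ∧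
      w = (ψ ⋆[ContinuousLinearMap.lsmul ℝ ℝ, volume] (indicator (cthickening δ K) u)) ∧
      (∀ x ∈ K, w x = moll d Ω ψ u x) ∧
      ∀ x ∈ K, ‖fderiv ℝ w x‖ ≤ ∑ i, |moll d Ω ψ (G i) x| := by
  set K' := cthickening δ K
  have hK' : IsCompact K' := hK.cthickening
  have hKm : MeasurableSet K' := hK'.measurableSet
  have hIntg : Integrable (indicator K' u) volume := by
    rw [integrable_indicator_iff hKm]
    exact hu.li.integrableOn_compact_subset hKΩ hK'
  have hcs : HasCompactSupport ψ := by
    refine HasCompactSupport.of_support_subset_isCompact (isCompact_closedBall (0 : Ed d) δ) ?_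
    intro x hx
    rw [mem_closedBall, dist_zero_right]
    by_contra h
    exact hx (hψδ x (not_le.mp h).le)
  have hbig : ∀ (ζ : Ed d → ℝ), (∀ y, ζ y ≠ 0 → ‖y‖ ≤ δ) → ∀ x ∈ K,
      ∫ t, indicator K' u t * ζ (x - t) = ∫ t in Ω, u t * ζ (x - t) := by
    intro ζ hζ x hx
    have hsub : ∀ t, ζ (x - t) ≠ 0 → t ∈ K' := by
      intro t ht
      have := hζ _ ht
      exact mem_cthickening_of_dist_le t x δ K hx (by rw [dist_comm, dist_eq_norm]; exact this)
    have e1 : (fun t => indicator K' u t * ζ (x - t)) = indicator K' (fun t => u t * ζ (x - t)) := by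
      ext t; by_cases ht : t ∈ K' <;> simp [ht]
    rw [e1, integral_indicator hKm]
    refine (setIntegral_eq_of_subset_of_forall_sdiff_eq_zero ?_ hKΩ ?_).symm
    · exact hΩ.measurableSet
    · intro t ht
      have : ζ (x - t) = 0 := by
        by_contra h; exact ht.2 (hsub t h)
      rw [this, mul_zero]
  refine ⟨(indicator K' u) ⋆[ContinuousLinearMap.lsmul ℝ ℝ, volume] ψ,
    hcs.contDiff_convolution_right _ hIntg.locallyIntegrable hψ, ?_, ?_, ?_⟩
  · ext x
    rw [convolution_eq_swap]
    unfold convolution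
    simp [mul_comm]
  · intro x hx
    unfold convolution moll
    simp only [ContinuousLinearMap.lsmul_apply, smul_eq_mul]
    apply hbig ψ _ x hx
    intro y hy
    by_contra h
    exact hy (hψδ y (not_le.mp h).le)
  · intro x hx
    refine (opNorm_le_sum _).trans (Finset.sum_le_sum fun i _ => le_of_eq ?_)
    congr 1
    have h1 := hcs.hasFDerivAt_convolution_right (ContinuousLinearMap.lsmul ℝ ℝ) hIntg.locallyIntegrable
      (hψ.of_le (by exact_mod_cast le_top) : ContDiff ℝ 1 ψ) x
    rw [h1.fderiv, convolution_precompR_apply _ hIntg.locallyIntegrable (hcs.fderiv (𝕜 := ℝ))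
      (hψ.continuous_fderiv (by simp))]
    unfold convolution
    simp only [ContinuousLinearMap.lsmul_apply, smul_eq_mul]
    rw [hbig (fun y => fderiv ℝ ψ y (EuclideanSpace.single i 1)) _ x hx]
    · have hdist : tsupport (fun t => ψ (x - t)) ⊆ closedBall x δ := by
        refine closure_minimal ?_ isClosed_closedBall
        intro t ht
        rw [mem_closedBall, dist_comm, dist_eq_norm]
        by_contra h
        exact ht (hψδ _ (not_le.mp h).le)
      have htest : IsTestFun d Ω (fun t => ψ (x - t)) := by
        refine ⟨hψ.comp (contDiff_const.sub contDiff_id), ?_, ?_⟩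
        · exact (isCompact_closedBall x δ).of_isClosed_subset (isClosed_tsupport _) hdist
        · refine hdist.trans (Subset.trans ?_ hKΩ)
          intro t ht
          exact mem_cthickening_of_dist_le t x δ K hx ht
      have h2 := hu.ibp i _ htest
      unfold moll
      rw [← neg_neg (∫ t in Ω, G i t * ψ (x - t)), ← h2, ← integral_neg]
      congr 1
      ext t
      have hd : DifferentiableAt ℝ ψ (x - t) := hψ.differentiable (by simp) _
      have hin : HasFDerivAt (fun t : Ed d => x - t) (-ContinuousLinearMap.id ℝ (Ed d)) t :=
        (hasFDerivAt_id (𝕜 := ℝ) t).const_sub x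
      have e : fderiv ℝ (fun t => ψ (x - t)) t = (fderiv ℝ ψ (x - t)).comp (-ContinuousLinearMap.id ℝ (Ed d)) :=
        (HasFDerivAt.comp t (f := fun t : Ed d => x - t) hd.hasFDerivAt hin).fderiv
      simp only [pderivI]
      rw [e]; simp
    · intro y hy
      by_contra h
      apply hy
      have : y ∉ tsupport ψ := by
        have hs : tsupport ψ ⊆ closedBall 0 δ := by
          refine closure_minimal ?_ isClosed_closedBall
          intro t ht
          rw [mem_closedBall, dist_zero_right]
          by_contra h
          exact ht (hψδ _ (not_le.mp h).le)
        intro hy2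
        exact h (by simpa using hs hy2)
      have h0 : fderiv ℝ ψ y = 0 :=
        image_eq_zero_of_notMem_tsupport fun h => this (tsupport_fderiv_subset ℝ h)
      simp [h0]
end

section

variable {d : ℕ} {Ω : Set (Ed d)} {σ : Ed d → ℝ}

/-- First order weighted energy. -/
def enrg (d : ℕ) (Ω : Set (Ed d)) (σ : Ed d → ℝ) (a p : ℝ) (u : Ed d → ℝ) (G : Fin d → Ed d → ℝ) : ℝ≥0∞ :=
  (∫⁻ x in Ω, ENNReal.ofReal (σ x ^ (-a * p) * |u x| ^ p)) +
    ∑ i, ∫⁻ x in Ω, ENNReal.ofReal (σ x ^ ((1 - a) * p) * |G i x| ^ p)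

lemma pt_bound {s L p a A : ℝ} (hs : 0 < s) (hL : 0 ≤ L) (hp : 1 ≤ p) (N : ℝ) (hN0 : 0 ≤ N)
    (hA : 0 ≤ A) (B : Fin d → ℝ) (hB : ∀ i, 0 ≤ B i) (hN : N ≤ (1 + L) * (A + ∑ i, s * B i)) :
    s ^ (-a * p) * N ^ p ≤ ((1 + L) ^ p * (d + 1 : ℝ) ^ (p - 1)) *
      (s ^ (-a * p) * A ^ p + ∑ i, s ^ ((1 - a) * p) * B i ^ p) := by
  have h1 := Real.rpow_sum_le_const_mul_sum_rpow_of_nonneg (Finset.univ : Finset (Option (Fin d)))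
    (f := fun o => o.elim A (fun i => s * B i)) hp (by
      intro o _; cases o with
      | none => exact hA
      | some i => exact mul_nonneg hs.le (hB i))
  rw [Fintype.sum_option, Fintype.sum_option] at h1
  simp only [Option.elim, Finset.card_univ, Fintype.card_option, Fintype.card_fin] at h1
  push_cast at h1
  have h2 : N ^ p ≤ (1 + L) ^ p * (A + ∑ i, s * B i) ^ p := by
    rw [← Real.mul_rpow (by positivity)
      (add_nonneg hA (Finset.sum_nonneg fun i _ => mul_nonneg hs.le (hB i)))]
    exact Real.rpow_le_rpow hN0 hN (by linarith)
  have h3 : ∀ i, s ^ ((1 - a) * p) * B i ^ p = s ^ (-a * p) * (s * B i) ^ p := by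
    intro i
    rw [Real.mul_rpow hs.le (hB i), ← mul_assoc, ← Real.rpow_add hs]
    congr 2; ring
  simp_rw [h3]
  rw [← Finset.mul_sum, ← mul_add]
  have hsp : 0 < s ^ (-a * p) := by positivity
  calc s ^ (-a * p) * N ^ p ≤ s ^ (-a * p) * ((1 + L) ^ p * ((d + 1 : ℝ) ^ (p - 1) * (A ^ p + ∑ i, (s * B i) ^ p))) := by
        gcongr; exact h2.trans (by gcongr)
    _ = _ := by ring

lemma moll_meas {ψ g : Ed d → ℝ} (hψ : Continuous ψ)
    (hg : AEStronglyMeasurable g (volume.restrict Ω)) (K : Set (Ed d)) :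
    AEStronglyMeasurable (moll d Ω ψ g) (volume.restrict K) := by
  have h1 : Continuous fun z : Ed d × Ed d => ψ (z.1 - z.2) := by fun_prop
  have h2 : AEStronglyMeasurable (fun z : Ed d × Ed d => g z.2 * ψ (z.1 - z.2))
      ((volume.restrict K).prod (volume.restrict Ω)) :=
    (AEStronglyMeasurable.comp_snd hg).mul h1.aestronglyMeasurable
  exact h2.integral_prod_right'

lemma GoodWeight.moll_energy (hσ : GoodWeight d Ω σ) {p : ℝ} (hp : 1 ≤ p) (a : ℝ) {L : ℝ} (hL : 0 ≤ L) :
    ∃ B : ℝ≥0, ∀ (χ ψ u : Ed d → ℝ) (G : Fin d → Ed d → ℝ) (δ : ℝ) (w : Ed d → ℝ),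
      ContDiff ℝ (⊤ : ℕ∞) χ → HasCompactSupport χ → tsupport χ ⊆ Ω → (∀ x, |χ x| ≤ 1) →
      (∀ x, σ x * ‖fderiv ℝ χ x‖ ≤ L) → WG d Ω u G → Continuous ψ → (∀ x, 0 ≤ ψ x) →
      ∫⁻ x, ENNReal.ofReal (ψ x) = 1 → (∀ x, δ ≤ ‖x‖ → ψ x = 0) → 0 < δ →
      (∀ x ∈ tsupport χ, 2 * δ ≤ σ x) → ContDiff ℝ (⊤ : ℕ∞) w →
      (∀ x ∈ tsupport χ, w x = moll d Ω ψ u x) →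
      (∀ x ∈ tsupport χ, ‖fderiv ℝ w x‖ ≤ ∑ i, |moll d Ω ψ (G i) x|) →
      CC1 d Ω (fun x => χ x * w x) ∧
      ∫⁻ x, ENNReal.ofReal (σ x ^ (-a * p) * nrm1 d σ (fun x => χ x * w x) x ^ p) ≤
        B * enrg d Ω σ a p u G := by
  set M : ℝ := 2 ^ |-a * p| + 2 ^ |(1 - a) * p| with hM
  have hM1 : 2 ^ |-a * p| ≤ M := by rw [hM]; linarith [Real.rpow_pos_of_pos two_pos |(1 - a) * p|]
  have hM2 : 2 ^ |(1 - a) * p| ≤ M := by rw [hM]; linarith [Real.rpow_pos_of_pos two_pos |-a * p|]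
  set c : ℝ := (1 + L) ^ p * (d + 1 : ℝ) ^ (p - 1) with hc
  have hc0 : 0 ≤ c := by positivity
  refine ⟨(c * M).toNNReal, ?_⟩
  intro χ ψ u G δ w hχ hχc hχΩ hχ1 hχL hu hψ hψ0 hψ1 hψδ hδ hδσ hw hwu hwG
  have hs : tsupport (fun x => χ x * w x) ⊆ tsupport χ :=
    closure_mono (Function.support_mul_subset_left _ _)
  have hcc : CC1 d Ω (fun x => χ x * w x) :=
    ⟨(hχ.mul hw).of_le (by exact_mod_cast le_top), hχc.mul_right, hs.trans hχΩ⟩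
  refine ⟨hcc, ?_⟩
  have hKm : MeasurableSet (tsupport χ) := (isClosed_tsupport χ).measurableSet
  have hz : ∀ x, x ∉ tsupport χ → nrm1 d σ (fun x => χ x * w x) x = 0 := by
    intro x hx
    have h1 : fderiv ℝ (fun x => χ x * w x) x = 0 :=
      image_eq_zero_of_notMem_tsupport fun h => hx (hs (tsupport_fderiv_subset ℝ h))
    have h2 : χ x = 0 := image_eq_zero_of_notMem_tsupport hx
    simp [nrm1, h1, h2]
  have hum : AEStronglyMeasurable u (volume.restrict Ω) := hu.li.aestronglyMeasurable
  have hGm : ∀ i, AEStronglyMeasurable (G i) (volume.restrict Ω) := fun i => (hu.lg i).aestronglyMeasurable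
  have hpt : ∀ x ∈ tsupport χ, σ x ^ (-a * p) * nrm1 d σ (fun x => χ x * w x) x ^ p ≤
      c * (σ x ^ (-a * p) * |moll d Ω ψ u x| ^ p +
        ∑ i, σ x ^ ((1 - a) * p) * |moll d Ω ψ (G i) x| ^ p) := by
    intro x hx
    have hxΩ := hχΩ hx
    have hsx := hσ.pos x hxΩ
    apply pt_bound hsx hL hp _ (hσ.nrm1_nonneg hcc x) (abs_nonneg _) _ (fun i => abs_nonneg _)
    have e1 : fderiv ℝ (fun x => χ x * w x) x = χ x • fderiv ℝ w x + w x • fderiv ℝ χ x :=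
      fderiv_fun_mul (hχ.differentiable (by simp) x) (hw.differentiable (by simp) x)
    unfold nrm1
    have e2 : ‖fderiv ℝ (fun x => χ x * w x) x‖ ≤ |χ x| * ‖fderiv ℝ w x‖ + |w x| * ‖fderiv ℝ χ x‖ := by
      rw [e1]
      refine (norm_add_le _ _).trans ?_
      rw [norm_smul, norm_smul, Real.norm_eq_abs, Real.norm_eq_abs]
    have h1 := hχ1 x
    have h2 := hχL x
    have h3 := hwG x hx
    rw [hwu x hx] at e2
    have e3 : |χ x * w x| ≤ |moll d Ω ψ u x| := by
      rw [abs_mul, hwu x hx]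
      exact mul_le_of_le_one_left (abs_nonneg _) h1
    set A := |moll d Ω ψ u x|
    have hA : 0 ≤ A := abs_nonneg _
    set S := ∑ i, |moll d Ω ψ (G i) x|
    have hS : 0 ≤ S := Finset.sum_nonneg fun i _ => abs_nonneg _
    rw [← Finset.mul_sum]
    have e4 : |χ x| * ‖fderiv ℝ w x‖ ≤ S := by
      refine le_trans ?_ h3
      exact mul_le_of_le_one_left (norm_nonneg _) h1
    have e5 : σ x * ‖fderiv ℝ (fun x => χ x * w x) x‖ ≤ σ x * S + A * L := by
      calc _ ≤ σ x * (S + A * ‖fderiv ℝ χ x‖) := by gcongr; linarith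
        _ = σ x * S + A * (σ x * ‖fderiv ℝ χ x‖) := by ring
        _ ≤ _ := by gcongr
    have e6 : 0 ≤ L * (σ x * S) := by positivity
    nlinarith
  calc ∫⁻ x, ENNReal.ofReal (σ x ^ (-a * p) * nrm1 d σ (fun x => χ x * w x) x ^ p)
      = ∫⁻ x in tsupport χ, ENNReal.ofReal (σ x ^ (-a * p) * nrm1 d σ (fun x => χ x * w x) x ^ p) := by
        refine (setLIntegral_eq_of_support_subset ?_).symm
        intro x hx
        by_contra h
        apply hx
        simp only
        rw [hz x h, Real.zero_rpow (by linarith)]; simp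
    _ ≤ ∫⁻ x in tsupport χ, ENNReal.ofReal c * (ENNReal.ofReal (σ x ^ (-a * p) * |moll d Ω ψ u x| ^ p) +
        ∑ i, ENNReal.ofReal (σ x ^ ((1 - a) * p) * |moll d Ω ψ (G i) x| ^ p)) := by
        refine setLIntegral_mono' hKm fun x hx => ?_
        have hsx := hσ.nonneg x
        rw [← ENNReal.ofReal_sum_of_nonneg (fun i _ => by positivity),
          ← ENNReal.ofReal_add (by positivity) (Finset.sum_nonneg fun i _ => by positivity),
          ← ENNReal.ofReal_mul hc0]
        exact ENNReal.ofReal_le_ofReal (hpt x hx)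
    _ = ENNReal.ofReal c * ((∫⁻ x in tsupport χ, ENNReal.ofReal (σ x ^ (-a * p) * |moll d Ω ψ u x| ^ p)) +
        ∑ i, ∫⁻ x in tsupport χ, ENNReal.ofReal (σ x ^ ((1 - a) * p) * |moll d Ω ψ (G i) x| ^ p)) := by
        have hσm := hσ.lip.continuous.measurable
        have hm : ∀ (g : Ed d → ℝ), AEStronglyMeasurable g (volume.restrict Ω) → ∀ b : ℝ,
            AEMeasurable (fun x => ENNReal.ofReal (σ x ^ b * |moll d Ω ψ g x| ^ p))
              (volume.restrict (tsupport χ)) := fun g hg b =>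
          ((hσm.pow_const b).aemeasurable.mul
            ((moll_meas hψ hg _).aemeasurable.abs.pow_const p)).ennreal_ofReal
        rw [lintegral_const_mul' _ _ ENNReal.ofReal_ne_top, lintegral_add_left' (hm u hum _),
          lintegral_finsetSum' _ (fun i _ => hm (G i) (hGm i) _)]
    _ ≤ ENNReal.ofReal c * (ENNReal.ofReal M * (∫⁻ x in Ω, ENNReal.ofReal (σ x ^ (-a * p) * |u x| ^ p)) +
        ∑ i, ENNReal.ofReal M * ∫⁻ x in Ω, ENNReal.ofReal (σ x ^ ((1 - a) * p) * |G i x| ^ p)) := by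
        gcongr with i
        · refine (hσ.moll_bound hψ hψ0 hψ1 hum hp _ hδ hχc hδσ hψδ).trans ?_
          gcongr
        · refine (hσ.moll_bound hψ hψ0 hψ1 (hGm i) hp _ hδ hχc hδσ hψδ).trans ?_
          gcongr
    _ = _ := by
        rw [← Finset.mul_sum, ← mul_add, ← mul_assoc, ← ENNReal.ofReal_mul hc0]
        rfl
end

section

variable {d : ℕ} {Ω : Set (Ed d)} {σ : Ed d → ℝ}

lemma fatou_le {α : Type*} [MeasurableSpace α] {μ : Measure α} {f : ℕ → α → ℝ≥0∞} {g : α → ℝ≥0∞}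
    {B : ℝ≥0∞} (hm : ∀ n, AEMeasurable (f n) μ) (hB : ∀ n, ∫⁻ x, f n x ∂μ ≤ B)
    (hl : ∀ᵐ x ∂μ, Tendsto (fun n => f n x) atTop (𝓝 (g x))) : ∫⁻ x, g x ∂μ ≤ B := by
  calc ∫⁻ x, g x ∂μ = ∫⁻ x, liminf (fun n => f n x) atTop ∂μ :=
        lintegral_congr_ae (hl.mono fun x hx => hx.liminf_eq.symm)
    _ ≤ liminf (fun n => ∫⁻ x, f n x ∂μ) atTop := lintegral_liminf_le' hm
    _ ≤ liminf (fun _ : ℕ => B) atTop := liminf_le_liminf (Eventually.of_forall hB)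
    _ = B := by simp

lemma tendsto_integrand {c q t s : ℝ} (hq : 0 < q) {w : ℕ → ℝ} (h : Tendsto w atTop (𝓝 t)) :
    Tendsto (fun n => ENNReal.ofReal (s ^ c * |w n| ^ q)) atTop
      (𝓝 (ENNReal.ofReal (s ^ c * |t| ^ q))) := by
  apply ENNReal.tendsto_ofReal
  apply Tendsto.const_mul
  exact h.abs.rpow_const (Or.inr hq.le)

/-- First order weighted Sobolev inequality for weakly differentiable functions. -/
lemma GoodWeight.weak_step (hσ : GoodWeight d Ω σ) (hd : 2 ≤ d) {p q : ℝ} (hp : 1 ≤ p) (hpq : p ≤ q)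
    (h : d / p - d / q ≤ 1) (a : ℝ) :
    ∃ C : ℝ≥0, ∀ u G, WG d Ω u G →
      ∫⁻ x in Ω, ENNReal.ofReal (σ x ^ (-(a - d / p + d / q) * q) * |u x| ^ q) ≤
      C * (enrg d Ω σ a p u G) ^ (q / p) := by
  obtain ⟨C, hC⟩ := hσ.core hd hp hpq h a
  obtain ⟨L, χ, hL, hχ, hχ1⟩ := hσ.cutoff
  obtain ⟨B, hB⟩ := hσ.moll_energy hp a hL
  have hq0 : 0 < q := by linarith
  have hp0 : 0 < p := by linarith
  set b := -(a - d / p + d / q) * q with hb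
  refine ⟨C * B ^ (q / p), fun u G hu => ?_⟩
  have hum : AEStronglyMeasurable u (volume.restrict Ω) := hu.li.aestronglyMeasurable
  have hσm := hσ.lip.continuous.measurable
  have key : ∀ n, ∫⁻ x in Ω, ENNReal.ofReal (σ x ^ b * |χ n x * u x| ^ q) ≤
      C * (B * enrg d Ω σ a p u G) ^ (q / p) := by
    intro n
    obtain ⟨c1, c2, c3, c4, c5⟩ := hχ n
    set K := tsupport (χ n) with hK
    have hKc : IsCompact K := c2
    obtain ⟨δ₁, hδ₁, hδ₁K⟩ := hKc.exists_cthickening_subset_open hσ.isOpen c3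
    obtain ⟨δ₂, hδ₂, hδ₂K⟩ : ∃ δ₂ > 0, ∀ x ∈ K, 2 * δ₂ ≤ σ x := by
      rcases K.eq_empty_or_nonempty with he | hne
      · exact ⟨1, one_pos, by simp [he]⟩
      · obtain ⟨y, hy, hy2⟩ := hKc.exists_isMinOn hne hσ.lip.continuous.continuousOn
        refine ⟨σ y / 2, half_pos (hσ.pos y (c3 hy)), fun x hx => ?_⟩
        have := hy2 hx
        simp only [mem_ofPred_eq] at this
        linarith
    set δ := min δ₁ δ₂ with hδ
    have hδ0 : 0 < δ := lt_min hδ₁ hδ₂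
    have hδK : cthickening δ K ⊆ Ω := (cthickening_mono (min_le_left _ _) _).trans hδ₁K
    have hδσ : ∀ x ∈ K, 2 * δ ≤ σ x := fun x hx => by
      have := hδ₂K x hx; have := min_le_right δ₁ δ₂; linarith
    let φ : ℕ → ContDiffBump (0 : Ed d) := fun k =>
      ⟨δ / (k + 1) / 2, δ / (k + 1), by positivity, by
        have : 0 < δ / (k + 1) := by positivity
        linarith⟩
    have hφδ : ∀ k x, δ ≤ ‖x‖ → (φ k).normed volume x = 0 := by
      intro k x hx
      by_contra hne
      have : x ∈ Function.support ((φ k).normed volume) := hne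
      rw [ContDiffBump.support_normed_eq, mem_ball_zero_iff] at this
      have h2 : (φ k).rOut ≤ δ := div_le_self hδ0.le (by
        have : (0:ℝ) ≤ k := Nat.cast_nonneg k
        linarith)
      linarith
    have hφ1 : ∀ k, ∫⁻ x, ENNReal.ofReal ((φ k).normed volume x) = 1 := by
      intro k
      rw [← ofReal_integral_eq_lintegral_ofReal (φ k).integrable_normed
        (Eventually.of_forall (φ k).nonneg_normed), ContDiffBump.integral_normed, ENNReal.ofReal_one]
    have hw := fun k => moll_deriv hσ.isOpen hu (φ k).contDiff_normed (hφδ k) hKc hδK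
    choose w w1 w2 w3 w4 using hw
    have hE := fun k => hB (χ n) ((φ k).normed volume) u G δ (w k) c1 c2 c3 c4 c5 hu
      (φ k).continuous_normed (φ k).nonneg_normed (hφ1 k) (hφδ k) hδ0 hδσ (w1 k) (w3 k) (w4 k)
    have hIntg : LocallyIntegrable (indicator (cthickening δ K) u) volume := by
      apply Integrable.locallyIntegrable
      rw [integrable_indicator_iff hKc.cthickening.measurableSet]
      exact hu.li.integrableOn_compact_subset hδK hKc.cthickening
    have hrout : Tendsto (fun k => (φ k).rOut) atTop (𝓝 0) :=
      tendsto_const_div_atTop_nhds_zero_nat δ |>.comp (tendsto_add_atTop_nat 1) |>.congr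
        (fun k => by simp [φ])
    have hconv := ContDiffBump.ae_convolution_tendsto_right_of_locallyIntegrable (K := 2) hrout
      (Eventually.of_forall fun k => by
        show δ / (k + 1) ≤ 2 * (δ / (k + 1) / 2)
        linarith) hIntg
    refine fatou_le (f := fun k x => ENNReal.ofReal (σ x ^ b * |χ n x * w k x| ^ q)) ?_ ?_ ?_
    · intro k
      have : Continuous fun x => χ n x * w k x := c1.continuous.mul (w1 k).continuous
      exact ((hσm.pow_const b).mul (this.measurable.abs.pow_const q)).ennreal_ofReal.aemeasurable
    · intro k
      refine (setLIntegral_le_lintegral _ _).trans ((hC _ (hE k).1).trans ?_)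
      gcongr
      exact (hE k).2
    · filter_upwards [ae_restrict_of_ae hconv] with x hx
      apply tendsto_integrand hq0
      by_cases hxK : x ∈ K
      · have : indicator (cthickening δ K) u x = u x :=
          indicator_of_mem (self_subset_cthickening K hxK) _
        rw [this] at hx
        apply Tendsto.const_mul
        refine hx.congr fun k => ?_
        rw [w2 k]
      · have : χ n x = 0 := image_eq_zero_of_notMem_tsupport hxK
        simp [this]
  have hfin : ∫⁻ x in Ω, ENNReal.ofReal (σ x ^ b * |u x| ^ q) ≤
      C * (B * enrg d Ω σ a p u G) ^ (q / p) := by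
    refine fatou_le (f := fun n x => ENNReal.ofReal (σ x ^ b * |χ n x * u x| ^ q)) ?_ key ?_
    · intro n
      have : AEMeasurable (fun x => χ n x * u x) (volume.restrict Ω) :=
        (hχ n).1.continuous.measurable.aemeasurable.mul hum.aemeasurable
      exact ((hσm.pow_const b).aemeasurable.mul (this.abs.pow_const q)).ennreal_ofReal
    · filter_upwards [ae_restrict_mem hσ.isOpen.measurableSet] with x hx
      apply tendsto_integrand hq0
      simpa using (hχ1 x hx).mul_const (u x)
  refine hfin.trans (le_of_eq ?_)
  rw [ENNReal.mul_rpow_of_nonneg _ _ (by positivity), ← mul_assoc, ENNReal.coe_mul,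
    ENNReal.coe_rpow_of_nonneg _ (by positivity)]
end

section

/-- Projection onto the first `d - ℓ` coordinates. -/
def prj (d ℓ : ℕ) : Ed d →ₗ[ℝ] Ed d where
  toFun x := WithLp.toLp 2 fun i => if (i : ℕ) < d - ℓ then x i else 0
  map_add' x y := by ext i; by_cases h : (i : ℕ) < d - ℓ <;> simp [h]
  map_smul' c x := by ext i; by_cases h : (i : ℕ) < d - ℓ <;> simp [h]

lemma prj_apply (d ℓ : ℕ) (x : Ed d) (i : Fin d) : prj d ℓ x i = if (i : ℕ) < d - ℓ then x i else 0 := rfl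

lemma norm_prj (d ℓ : ℕ) (x : Ed d) : ‖prj d ℓ x‖ =
    Real.sqrt (∑ i ∈ Finset.univ.filter (fun i : Fin d => (i : ℕ) < d - ℓ), (x i) ^ 2) := by
  rw [EuclideanSpace.norm_eq, Finset.sum_filter]
  congr 1
  refine Finset.sum_congr rfl fun i _ => ?_
  rw [prj_apply]; split_ifs <;> simp

lemma rhoModel_eq (d ℓ : ℕ) (x : Ed d) : rhoModel d ℓ x = min 1 ‖prj d ℓ x‖ := by
  rw [norm_prj]; rfl

lemma norm_prj_le (d ℓ : ℕ) (x : Ed d) : ‖prj d ℓ x‖ ≤ ‖x‖ := by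
  rw [EuclideanSpace.norm_eq, EuclideanSpace.norm_eq]
  apply Real.sqrt_le_sqrt
  refine Finset.sum_le_sum fun i _ => ?_
  rw [prj_apply]; split_ifs <;> simp [sq_nonneg]

lemma mem_model_iff (d ℓ : ℕ) (x : Ed d) : x ∈ ModelDomain d ℓ ↔ prj d ℓ x ≠ 0 := by
  unfold ModelDomain RStar
  rw [mem_compl_iff, mem_ofPred_eq, not_iff_not]
  constructor
  · intro h; ext i; rw [prj_apply]; split_ifs with hi
    · simp [h i hi]
    · simp
  · intro h i hi
    have := congrArg (fun y : Ed d => y i) h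
    simpa [prj_apply, hi] using this

/-- The smooth model weight. -/
def sgm (d ℓ : ℕ) (x : Ed d) : ℝ := Real.sin (Real.arctan ‖prj d ℓ x‖)

lemma arctan_lip : LipschitzWith 1 Real.arctan := by
  apply lipschitzWith_of_nnnorm_deriv_le Real.differentiable_arctan
  intro x
  rw [← NNReal.coe_le_coe, coe_nnnorm, Real.deriv_arctan, Real.norm_of_nonneg (by positivity), NNReal.coe_one]
  rw [div_le_one (by positivity)]; nlinarith [sq_nonneg x]

lemma sin_lip : LipschitzWith 1 Real.sin := by
  apply lipschitzWith_of_nnnorm_deriv_le Real.differentiable_sin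
  intro x
  rw [← NNReal.coe_le_coe, coe_nnnorm, Real.deriv_sin, NNReal.coe_one]
  exact Real.abs_cos_le_one x

lemma prj_lip (d ℓ : ℕ) : LipschitzWith 1 (fun x => ‖prj d ℓ x‖) := by
  apply LipschitzWith.of_dist_le_mul
  intro x y
  rw [NNReal.coe_one, one_mul, Real.dist_eq, dist_eq_norm]
  refine (abs_norm_sub_norm_le _ _).trans ?_
  rw [← map_sub]; exact norm_prj_le d ℓ _

lemma prj_cont (d ℓ : ℕ) : Continuous (prj d ℓ) := (prj d ℓ).continuous_of_finiteDimensional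

lemma sgm_eq (d ℓ : ℕ) (x : Ed d) : sgm d ℓ x = ‖prj d ℓ x‖ / √(1 + ‖prj d ℓ x‖ ^ 2) := Real.sin_arctan _

lemma goodWeight_model (d ℓ : ℕ) : GoodWeight d (ModelDomain d ℓ) (sgm d ℓ) where
  isOpen := by
    have : ModelDomain d ℓ = {x | prj d ℓ x ≠ 0} := by ext x; exact mem_model_iff d ℓ x
    rw [this]
    exact isOpen_ne_fun (prj_cont d ℓ) continuous_const
  pos x hx := by
    rw [mem_model_iff] at hx
    rw [sgm_eq]
    have := norm_pos_iff.mpr hx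
    positivity
  smooth x hx := by
    rw [mem_model_iff] at hx
    have h1 : ContDiff ℝ (⊤ : ℕ∞) (prj d ℓ) := (LinearMap.toContinuousLinearMap (prj d ℓ)).contDiff
    have h2 : ContDiffAt ℝ (⊤ : ℕ∞) (fun x => ‖prj d ℓ x‖) x := h1.contDiffAt.norm ℝ hx
    exact Real.contDiff_sin.contDiffAt.comp x (Real.contDiff_arctan.contDiffAt.comp x h2)
  lip := by
    have := sin_lip.comp (arctan_lip.comp (prj_lip d ℓ))
    rw [one_mul, one_mul] at this
    exact this
  nonneg x := by rw [sgm_eq]; positivity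
  zero x hx := by
    rw [mem_model_iff, not_not] at hx
    simp [sgm, hx]
  le_one x := Real.sin_le_one _

lemma sgm_le (d ℓ : ℕ) (x : Ed d) : sgm d ℓ x ≤ 2 * rhoModel d ℓ x := by
  have h0 := norm_nonneg (prj d ℓ x)
  have : sgm d ℓ x ≤ rhoModel d ℓ x := by
    rw [rhoModel_eq]
    refine le_min (Real.sin_le_one _) ?_
    rw [sgm_eq]
    apply div_le_self h0
    rw [Real.one_le_sqrt]; nlinarith
  have h1 : 0 ≤ rhoModel d ℓ x := by rw [rhoModel_eq]; positivity
  linarith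

lemma rho_le (d ℓ : ℕ) (x : Ed d) : rhoModel d ℓ x ≤ 2 * sgm d ℓ x := by
  have h0 := norm_nonneg (prj d ℓ x)
  rw [rhoModel_eq, sgm_eq]
  set r := ‖prj d ℓ x‖
  rw [← mul_div_assoc, le_div_iff₀ (by positivity)]
  rcases le_total r 1 with h | h
  · rw [min_eq_right h]
    have : √(1 + r ^ 2) ≤ 2 := by
      rw [Real.sqrt_le_left (by norm_num)]; nlinarith
    nlinarith
  · rw [min_eq_left h, one_mul, Real.sqrt_le_left (by linarith)]; nlinarith

lemma rho_pos {d ℓ : ℕ} {x : Ed d} (hx : x ∈ ModelDomain d ℓ) : 0 < rhoModel d ℓ x := by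
  rw [mem_model_iff] at hx
  rw [rhoModel_eq]
  exact lt_min one_pos (norm_pos_iff.mpr hx)

lemma rho_le_one (d ℓ : ℕ) (x : Ed d) : rhoModel d ℓ x ≤ 1 := by
  rw [rhoModel_eq]; exact min_le_left _ _

lemma rho_cont (d ℓ : ℕ) : Continuous (rhoModel d ℓ) := by
  have : rhoModel d ℓ = fun x => min 1 ‖prj d ℓ x‖ := funext (rhoModel_eq d ℓ)
  rw [this]
  exact continuous_const.min (prj_cont d ℓ).norm
end

section

variable {d : ℕ} {Ω : Set (Ed d)} {σ : Ed d → ℝ}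

/-- Length of a multi-index. -/
def alen (d : ℕ) (α : Fin d → ℕ) : ℕ := ∑ i, α i

lemma mem_multiIdx {d m : ℕ} {α : Fin d → ℕ} : α ∈ multiIdx d m ↔ alen d α ≤ m := by
  unfold multiIdx alen
  rw [Finset.mem_filter, Fintype.mem_piFinset, and_iff_right_iff_imp]
  intro h i
  rw [Finset.mem_range]
  have := Finset.single_le_sum (f := α) (fun j _ => Nat.zero_le _) (Finset.mem_univ i)
  omega

lemma alen_add_single (α : Fin d → ℕ) (i : Fin d) : alen d (α + Pi.single i 1) = alen d α + 1 := by
  unfold alen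
  simp [Finset.sum_add_distrib]

/-- The weighted integral of one derivative. -/
def jint (d : ℕ) (Ω : Set (Ed d)) (σ : Ed d → ℝ) (a p : ℝ) (α : Fin d → ℕ) (v : Ed d → ℝ) : ℝ≥0∞ :=
  ∫⁻ x in Ω, ENNReal.ofReal (σ x ^ (((alen d α : ℝ) - a) * p) * |v x| ^ p)

/-- The `p`-th power of the norm as an extended real. -/
def nint (d : ℕ) (Ω : Set (Ed d)) (σ : Ed d → ℝ) (m : ℕ) (a p : ℝ) (D : (Fin d → ℕ) → Ed d → ℝ) : ℝ≥0∞ :=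
  ∑ α ∈ multiIdx d m, jint d Ω σ a p α (D α)

lemma jint_le_nint {m : ℕ} {a p : ℝ} {D : (Fin d → ℕ) → Ed d → ℝ} {α : Fin d → ℕ} (h : alen d α ≤ m) :
    jint d Ω σ a p α (D α) ≤ nint d Ω σ m a p D :=
  Finset.single_le_sum (f := fun α => jint d Ω σ a p α (D α)) (fun _ _ => zero_le) (mem_multiIdx.mpr h)

/-- Families for which neighbouring members are related by weak differentiation. -/
def WFam (d : ℕ) (Ω : Set (Ed d)) (m : ℕ) (D : (Fin d → ℕ) → Ed d → ℝ) : Prop :=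
  ∀ α, alen d α + 1 ≤ m → WG d Ω (D α) (fun i => D (α + Pi.single i 1))

lemma GoodWeight.fam_step (hσ : GoodWeight d Ω σ) (hd : 2 ≤ d) {p q : ℝ} (hp : 1 ≤ p) (hpq : p ≤ q)
    (h : d / p - d / q ≤ 1) (a : ℝ) (m : ℕ) :
    ∃ C : ℝ≥0, ∀ D, WFam d Ω (m + 1) D →
      nint d Ω σ m (a - d / p + d / q) q D ≤ C * (nint d Ω σ (m + 1) a p D) ^ (q / p) := by
  choose C hC using fun α : Fin d → ℕ => hσ.weak_step hd hp hpq h (a - alen d α)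
  refine ⟨∑ α ∈ multiIdx d m, C α * (1 + d : ℝ≥0) ^ (q / p), fun D hD => ?_⟩
  have hqp : 0 ≤ q / p := by apply div_nonneg <;> linarith
  unfold nint
  push_cast
  rw [Finset.sum_mul]
  refine Finset.sum_le_sum fun α hα => ?_
  rw [mem_multiIdx] at hα
  have h1 := hC α _ _ (hD α (by omega))
  have h2 : enrg d Ω σ (a - alen d α) p (D α) (fun i => D (α + Pi.single i 1)) ≤
      (1 + d : ℝ≥0) * nint d Ω σ (m + 1) a p D := by
    have e1 : enrg d Ω σ (a - alen d α) p (D α) (fun i => D (α + Pi.single i 1)) =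
        jint d Ω σ a p α (D α) + ∑ i, jint d Ω σ a p (α + Pi.single i 1) (D (α + Pi.single i 1)) := by
      unfold enrg jint
      congr 1
      · congr 1; ext x; congr 3; ring
      · refine Finset.sum_congr rfl fun i _ => ?_
        congr 1; ext x; congr 3; rw [alen_add_single]; push_cast; ring
    rw [e1]
    calc _ ≤ nint d Ω σ (m + 1) a p D + ∑ i : Fin d, nint d Ω σ (m + 1) a p D := by
          gcongr with i
          · exact jint_le_nint (by omega)
          · exact jint_le_nint (by rw [alen_add_single]; omega)
      _ = _ := by simp; ring
  have e2 : jint d Ω σ (a - d / p + d / q) q α (D α) =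
      ∫⁻ x in Ω, ENNReal.ofReal (σ x ^ (-(a - alen d α - d / p + d / q) * q) * |D α x| ^ q) := by
    unfold jint; congr 1; ext x; congr 3; ring
  rw [e2]
  refine h1.trans ?_
  have e3 : ((C α * (1 + d : ℝ≥0) ^ (q / p) : ℝ≥0) : ℝ≥0∞) * (nint d Ω σ (m + 1) a p D) ^ (q / p)
      = C α * ((1 + d : ℝ≥0) * nint d Ω σ (m + 1) a p D) ^ (q / p) := by
    rw [ENNReal.mul_rpow_of_nonneg _ _ hqp, ENNReal.coe_mul, ENNReal.coe_rpow_of_nonneg _ hqp, mul_assoc]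
  unfold nint at e3 h2
  push_cast at e3 h2
  rw [e3]
  gcongr

lemma GoodWeight.fam (hσ : GoodWeight d Ω σ) (hd : 2 ≤ d) (k : ℕ) : ∀ {p q : ℝ}, 1 ≤ p → p ≤ q →
    d / p - d / q ≤ k → ∀ (a : ℝ) (m : ℕ),
    ∃ C : ℝ≥0, ∀ D, WFam d Ω (m + k) D →
      nint d Ω σ m (a - d / p + d / q) q D ≤ C * (nint d Ω σ (m + k) a p D) ^ (q / p) := by
  have hd0 : (0:ℝ) < d := by exact_mod_cast (by omega : 0 < d)
  induction k with
  | zero =>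
    intro p q hp hpq h a m
    have hpq' : p = q := by
      apply le_antisymm hpq
      have h0 : (d:ℝ) / p ≤ d / q := by simpa using h
      exact (div_le_div_iff_of_pos_left hd0 (by linarith) (by linarith)).mp h0
    subst hpq'
    refine ⟨1, fun D _ => ?_⟩
    rw [div_self (by linarith : p ≠ 0)]
    simp
  | succ k ih =>
    intro p q hp hpq h a m
    have hp0 : 0 < p := by linarith
    have hq0 : 0 < q := by linarith
    have hk : (0:ℝ) < k + 1 := by positivity
    set s : ℝ := 1 / p - (1 / p - 1 / q) / (k + 1) with hs
    have h1 : 1 / q ≤ 1 / p := one_div_le_one_div_of_le hp0 hpq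
    have h2 : (1 / p - 1 / q) / (k + 1) ≤ 1 / p - 1 / q := by
      apply div_le_self (by linarith)
      have : (0:ℝ) ≤ k := Nat.cast_nonneg k
      linarith
    have h3 : 0 ≤ (1 / p - 1 / q) / (k + 1) := div_nonneg (by linarith) hk.le
    have hsq : 1 / q ≤ s := by linarith
    have hsp : s ≤ 1 / p := by linarith
    have hs0 : 0 < s := lt_of_lt_of_le (by positivity) hsq
    have hpr : p ≤ 1 / s := by rw [le_div_iff₀ hs0]; rw [le_div_iff₀ hp0] at hsp; linarith
    have hrq : 1 / s ≤ q := by rw [div_le_iff₀ hs0]; rw [div_le_iff₀ hq0] at hsq; linarith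
    have e : (d:ℝ) / (1 / s) = d * s := by field_simp
    have hdd : d / p - d / q = d * (1 / p - 1 / q) := by ring
    have hd1 : d / p - d / (1 / s) = (d / p - d / q) / (k + 1) := by rw [e, hs]; ring
    have hd2 : d / (1 / s) - d / q = (d / p - d / q) / (k + 1) * k := by
      rw [e, hs]; field_simp; ring
    push_cast at h
    have hd3 : (d / p - d / q) / (k + 1) ≤ 1 := by rw [div_le_one hk]; exact h
    obtain ⟨C1, hC1⟩ := hσ.fam_step hd hp hpr (by rw [hd1]; exact hd3) a (m + k)
    obtain ⟨C2, hC2⟩ := ih (hp.trans hpr) hrq (by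
      rw [hd2]; exact mul_le_of_le_one_left (Nat.cast_nonneg k) hd3) (a - d / p + d / (1 / s)) m
    refine ⟨C2 * C1 ^ (q / (1 / s)), fun D hD => ?_⟩
    have g1 := hC1 D hD
    have g2 := hC2 D (fun α hα => hD α (by omega))
    have e5 : a - d / p + d / (1 / s) - d / (1 / s) + d / q = a - d / p + d / q := by ring
    rw [e5] at g2
    have hqs : 0 ≤ q / (1 / s) := by positivity
    refine g2.trans ?_
    calc _ ≤ (C2:ℝ≥0∞) * (C1 * (nint d Ω σ (m + k + 1) a p D) ^ ((1 / s) / p)) ^ (q / (1 / s)) := by gcongr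
      _ = _ := by
        rw [ENNReal.mul_rpow_of_nonneg _ _ hqs, ← ENNReal.rpow_mul, ENNReal.coe_mul,
          ENNReal.coe_rpow_of_nonneg _ hqs, mul_assoc, ← add_assoc]
        congr 3
        field_simp
end

section

variable {d : ℕ} {Ω : Set (Ed d)} {σ : Ed d → ℝ}

lemma smooth_pderivI {f : Ed d → ℝ} (hf : ContDiff ℝ (⊤ : ℕ∞) f) (i : Fin d) :
    ContDiff ℝ (⊤ : ℕ∞) (pderivI d i f) := by
  have h : ContDiff ℝ (⊤ : ℕ∞) (fderiv ℝ f) := hf.fderiv_right (by simp)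
  exact h.clm_apply contDiff_const

lemma tsupport_pderivI {f : Ed d → ℝ} (i : Fin d) : tsupport (pderivI d i f) ⊆ tsupport f := by
  refine closure_minimal ?_ (isClosed_tsupport f)
  intro x hx
  by_contra h
  apply hx
  have h0 : fderiv ℝ f x = 0 :=
    image_eq_zero_of_notMem_tsupport fun h' => h (tsupport_fderiv_subset ℝ h')
  simp [pderivI, h0]

lemma IsTestFun.pderivI {f : Ed d → ℝ} (hf : IsTestFun d Ω f) (i : Fin d) :
    IsTestFun d Ω (pderivI d i f) :=
  ⟨smooth_pderivI hf.1 i, hf.2.1.of_isClosed_subset (isClosed_tsupport _) (tsupport_pderivI i),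
    (tsupport_pderivI i).trans hf.2.2⟩

lemma pderivI_comm {f : Ed d → ℝ} (hf : ContDiff ℝ (⊤ : ℕ∞) f) (i j : Fin d) :
    pderivI d i (pderivI d j f) = pderivI d j (pderivI d i f) := by
  ext x
  have hd : Differentiable ℝ (fderiv ℝ f) :=
    (hf.fderiv_right (m := (⊤ : ℕ∞)) (by simp)).differentiable (by simp)
  have key : ∀ k l : Fin d, pderivI d k (pderivI d l f) x =
      fderiv ℝ (fderiv ℝ f) x (EuclideanSpace.single k 1) (EuclideanSpace.single l 1) := by
    intro k l
    have := (hd x).hasFDerivAt.clm_apply (hasFDerivAt_const (EuclideanSpace.single l (1:ℝ)) x)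
    unfold pderivI
    rw [this.fderiv]; simp
  rw [key, key]
  have hs : IsSymmSndFDerivAt ℝ f x := (hf.contDiffAt).isSymmSndFDerivAt (by simp only [minSmoothness_of_isRCLikeNormedField]; exact WithTop.coe_le_coe.mpr (le_top : (2 : ℕ∞) ≤ ⊤))
  exact hs.eq _ _

lemma smooth_iter {f : Ed d → ℝ} (hf : ContDiff ℝ (⊤ : ℕ∞) f) (i : Fin d) (n : ℕ) :
    ContDiff ℝ (⊤ : ℕ∞) ((pderivI d i)^[n] f) := by
  induction n with
  | zero => exact hf
  | succ n ih => rw [Function.iterate_succ_apply']; exact smooth_pderivI ih i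

lemma iter_comm {f : Ed d → ℝ} (hf : ContDiff ℝ (⊤ : ℕ∞) f) (i j : Fin d) (n : ℕ) :
    (pderivI d j)^[n] (pderivI d i f) = pderivI d i ((pderivI d j)^[n] f) := by
  induction n with
  | zero => rfl
  | succ n ih =>
    rw [Function.iterate_succ_apply', Function.iterate_succ_apply', ih,
      pderivI_comm (smooth_iter hf j n)]

/-- Partial product of derivatives along a list. -/
def pdl (d : ℕ) (l : List (Fin d)) (α : Fin d → ℕ) : (Ed d → ℝ) → Ed d → ℝ :=
  l.foldr (fun i g => (pderivI d i)^[α i] ∘ g) id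

lemma pdl_cons (j : Fin d) (l : List (Fin d)) (α : Fin d → ℕ) (f : Ed d → ℝ) :
    pdl d (j :: l) α f = (pderivI d j)^[α j] (pdl d l α f) := rfl

lemma smooth_pdl {f : Ed d → ℝ} (hf : ContDiff ℝ (⊤ : ℕ∞) f) (l : List (Fin d)) (α : Fin d → ℕ) :
    ContDiff ℝ (⊤ : ℕ∞) (pdl d l α f) := by
  induction l with
  | nil => exact hf
  | cons j l ih => rw [pdl_cons]; exact smooth_iter ih j _

lemma pdl_comm {f : Ed d → ℝ} (hf : ContDiff ℝ (⊤ : ℕ∞) f) (l : List (Fin d)) (α : Fin d → ℕ) (i : Fin d) :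
    pdl d l α (pderivI d i f) = pderivI d i (pdl d l α f) := by
  induction l with
  | nil => rfl
  | cons j l ih => rw [pdl_cons, pdl_cons, ih, iter_comm (smooth_pdl hf l α)]

lemma pdl_notMem (l : List (Fin d)) (α : Fin d → ℕ) (i : Fin d) (f : Ed d → ℝ) (hi : i ∉ l) :
    pdl d l (α + Pi.single i 1) f = pdl d l α f := by
  induction l with
  | nil => rfl
  | cons j l ih =>
    simp only [List.mem_cons, not_or] at hi
    rw [pdl_cons, pdl_cons, ih hi.2]
    simp [Ne.symm hi.1]

lemma pdl_mem {f : Ed d → ℝ} (hf : ContDiff ℝ (⊤ : ℕ∞) f) (l : List (Fin d)) (α : Fin d → ℕ) (i : Fin d)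
    (hi : i ∈ l) (hl : l.Nodup) :
    pdl d l (α + Pi.single i 1) f = pdl d l α (pderivI d i f) := by
  induction l with
  | nil => simp at hi
  | cons j l ih =>
    rw [List.nodup_cons] at hl
    rw [pdl_cons, pdl_cons]
    by_cases hij : i = j
    · subst hij
      rw [pdl_notMem l α i f hl.1, pdl_comm hf]
      simp [Function.iterate_succ_apply]
    · have hi' : i ∈ l := by simpa [hij] using hi
      rw [ih hi' hl.2]
      simp [Ne.symm hij]

lemma pderivA_add_single {f : Ed d → ℝ} (hf : ContDiff ℝ (⊤ : ℕ∞) f) (α : Fin d → ℕ) (i : Fin d) :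
    pderivA d (α + Pi.single i 1) f = pderivA d α (pderivI d i f) :=
  pdl_mem hf (List.finRange d) α i (List.mem_finRange i) (List.nodup_finRange d)

lemma pderivA_comm {f : Ed d → ℝ} (hf : ContDiff ℝ (⊤ : ℕ∞) f) (α : Fin d → ℕ) (i : Fin d) :
    pderivA d α (pderivI d i f) = pderivI d i (pderivA d α f) :=
  pdl_comm hf (List.finRange d) α i

lemma pderivA_zero (f : Ed d → ℝ) : pderivA d 0 f = f := by
  have : ∀ l : List (Fin d), pdl d l 0 f = f := by
    intro l
    induction l with
    | nil => rfl
    | cons j l ih => rw [pdl_cons, ih]; rfl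
  exact this _

lemma smooth_pderivA {f : Ed d → ℝ} (hf : ContDiff ℝ (⊤ : ℕ∞) f) (α : Fin d → ℕ) :
    ContDiff ℝ (⊤ : ℕ∞) (pderivA d α f) := smooth_pdl hf _ α

lemma IsWeakDerivFamily.wfam {m : ℕ} {u : Ed d → ℝ} {D : (Fin d → ℕ) → Ed d → ℝ}
    (h : IsWeakDerivFamily d Ω m u D) : WFam d Ω m D := by
  intro α hα
  have h1 := h α (mem_multiIdx.mpr (by omega))
  have h2 : ∀ i, HasWeakDerivOn d Ω (α + Pi.single i 1) u (D (α + Pi.single i 1)) := fun i =>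
    h _ (mem_multiIdx.mpr (by rw [alen_add_single]; omega))
  refine ⟨h1.2.1, fun i => (h2 i).2.1, fun i φ hφ => ?_⟩
  have e1 := h1.2.2 _ (hφ.pderivI i)
  have e2 := (h2 i).2.2 φ hφ
  rw [pderivA_add_single hφ.1] at e2
  rw [e2] at e1
  have e3 : (∑ j, (α + Pi.single i 1 : Fin d → ℕ) j) = (∑ j, α j) + 1 := alen_add_single α i
  rw [e3, pow_succ] at e1
  have hne : ((-1 : ℝ) ^ (∑ j, α j)) ≠ 0 := by positivity
  apply mul_left_cancel₀ hne
  rw [← e1]; ring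

lemma HasWeakDerivOn.unique (hΩ : IsOpen Ω) {α : Fin d → ℕ} {u v w : Ed d → ℝ}
    (hv : HasWeakDerivOn d Ω α u v) (hw : HasWeakDerivOn d Ω α u w) :
    v =ᵐ[volume.restrict Ω] w := by
  have hl : LocallyIntegrableOn (fun x => v x - w x) Ω volume := hv.2.1.sub hw.2.1
  have key := hΩ.ae_eq_zero_of_integral_contDiff_smul_eq_zero hl (by
    intro φ hφ hc hs
    have hφt : IsTestFun d Ω φ := ⟨hφ, hc, hs⟩
    have e1 := hv.2.2 φ hφt
    have e2 := hw.2.2 φ hφt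
    rw [e1] at e2
    have hne : ((-1 : ℝ) ^ (∑ j, α j)) ≠ 0 := by positivity
    have e3 := mul_left_cancel₀ hne e2
    have hi : ∀ v : Ed d → ℝ, LocallyIntegrableOn v Ω volume → IntegrableOn (fun x => v x * φ x) Ω volume := by
      intro v hv
      have h1 : IntegrableOn (fun x => v x * φ x) (tsupport φ) volume :=
        (hv.integrableOn_compact_subset hs hc).mul_continuousOn hφ.continuous.continuousOn hc
      refine h1.of_forall_sdiff_eq_zero hΩ.measurableSet fun x hx => ?_
      rw [image_eq_zero_of_notMem_tsupport hx.2, mul_zero]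
    have e4 : ∫ x, φ x • (v x - w x) = ∫ x in Ω, φ x • (v x - w x) := by
      refine (setIntegral_eq_integral_of_forall_compl_eq_zero fun x hx => ?_).symm
      rw [image_eq_zero_of_notMem_tsupport fun h => hx (hs h), zero_smul]
    rw [e4]
    have e5 : ∀ x, φ x • (v x - w x) = v x * φ x - w x * φ x := fun x => by rw [smul_eq_mul]; ring
    simp_rw [e5]
    rw [integral_sub (hi v hv.2.1) (hi w hw.2.1), e3, sub_self])
  rw [Filter.EventuallyEq, ae_restrict_iff' hΩ.measurableSet]
  filter_upwards [key] with x hx hxΩ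
  linarith [hx hxΩ]

lemma Knorm_eq (hΩ : IsOpen Ω) {ρ : Ed d → ℝ} {m : ℕ} {a p : ℝ} {u : Ed d → ℝ} {D : (Fin d → ℕ) → Ed d → ℝ}
    (hD : KMemData d Ω ρ m a p u D) : Knorm d Ω ρ m a p u = KnormP d Ω ρ m a p D := by
  have hex : MemK d Ω ρ m a p u := ⟨D, hD⟩
  unfold Knorm
  rw [dif_pos hex]
  unfold KnormP
  congr 1
  refine Finset.sum_congr rfl fun α hα => ?_
  apply integral_congr_ae
  filter_upwards [HasWeakDerivOn.unique hΩ (hex.choose_spec.1 α hα) (hD.1 α hα)] with x hx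
  simp only [kIntegrand, hx]
end

section

variable {d : ℕ} {Ω : Set (Ed d)} {σ : Ed d → ℝ}

lemma kIntegrand_eq {ρ : Ed d → ℝ} (hρ : ∀ x, 0 ≤ ρ x) (a p : ℝ) (α : Fin d → ℕ) (v : Ed d → ℝ) (x : Ed d) :
    kIntegrand d ρ a p α v x = ρ x ^ (((alen d α : ℝ) - a) * p) * |v x| ^ p := by
  unfold kIntegrand alen
  rw [Real.mul_rpow (Real.rpow_nonneg (hρ x) _) (abs_nonneg _), ← Real.rpow_mul (hρ x)]

lemma kIntegrand_nonneg {ρ : Ed d → ℝ} (hρ : ∀ x, 0 ≤ ρ x) (a p : ℝ) (α : Fin d → ℕ) (v : Ed d → ℝ) (x : Ed d) :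
    0 ≤ kIntegrand d ρ a p α v x := by
  rw [kIntegrand_eq hρ]
  have := hρ x
  positivity

lemma jint_eq {ρ : Ed d → ℝ} (hρ : ∀ x, 0 ≤ ρ x) (a p : ℝ) (α : Fin d → ℕ) (v : Ed d → ℝ) :
    jint d Ω ρ a p α v = ∫⁻ x in Ω, ENNReal.ofReal (kIntegrand d ρ a p α v x) := by
  unfold jint
  simp_rw [kIntegrand_eq hρ]

lemma nint_compar (hΩ : IsOpen Ω) {s t : Ed d → ℝ} (hs : ∀ x ∈ Ω, 0 < s x) (h1 : ∀ x, s x ≤ 2 * t x)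
    (h2 : ∀ x, t x ≤ 2 * s x) (m : ℕ) (a p : ℝ) :
    ∃ B : ℝ≥0, ∀ D, nint d Ω s m a p D ≤ B * nint d Ω t m a p D := by
  refine ⟨∑ α ∈ multiIdx d m, Real.toNNReal (2 ^ |((alen d α : ℝ) - a) * p|), fun D => ?_⟩
  unfold nint
  push_cast
  rw [Finset.sum_mul]
  refine Finset.sum_le_sum fun α hα => ?_
  refine le_trans ?_ (mul_le_mul_right (jint_le_nint (mem_multiIdx.mp hα)) _)
  unfold jint
  change _ ≤ ENNReal.ofReal _ * _
  rw [← lintegral_const_mul' _ _ ENNReal.ofReal_ne_top]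
  refine setLIntegral_mono' hΩ.measurableSet fun x hx => ?_
  rw [← ENNReal.ofReal_mul (by positivity), ← mul_assoc]
  apply ENNReal.ofReal_le_ofReal
  gcongr
  exact rpow_compar (hs x hx) (h1 x) (h2 x) _

lemma nint_mono_a (hΩ : IsOpen Ω) {s : Ed d → ℝ} (hs : ∀ x ∈ Ω, 0 < s x) (h1 : ∀ x, s x ≤ 1)
    (m : ℕ) {a a' p : ℝ} (hp : 0 ≤ p) (ha : a' ≤ a) (D) :
    nint d Ω s m a' p D ≤ nint d Ω s m a p D := by
  unfold nint
  refine Finset.sum_le_sum fun α hα => ?_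
  unfold jint
  refine setLIntegral_mono' hΩ.measurableSet fun x hx => ?_
  apply ENNReal.ofReal_le_ofReal
  refine mul_le_mul_of_nonneg_right ?_ (by positivity)
  apply Real.rpow_le_rpow_of_exponent_ge (hs x hx) (h1 x)
  gcongr

lemma nint_eq_sum {ρ : Ed d → ℝ} (hρ : ∀ x, 0 ≤ ρ x) {m : ℕ} {a p : ℝ} {D : (Fin d → ℕ) → Ed d → ℝ}
    (h : ∀ α ∈ multiIdx d m, IntegrableOn (kIntegrand d ρ a p α (D α)) Ω volume) :
    nint d Ω ρ m a p D =
      ENNReal.ofReal (∑ α ∈ multiIdx d m, ∫ x in Ω, kIntegrand d ρ a p α (D α) x) := by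
  rw [ENNReal.ofReal_sum_of_nonneg fun α _ => integral_nonneg fun x => kIntegrand_nonneg hρ _ _ _ _ _]
  unfold nint
  refine Finset.sum_congr rfl fun α hα => ?_
  rw [jint_eq hρ, ofReal_integral_eq_lintegral_ofReal (h α hα)
    (Eventually.of_forall fun x => kIntegrand_nonneg hρ _ _ _ _ _)]

lemma integrable_of_nint {ρ : Ed d → ℝ} (hρ : ∀ x, 0 ≤ ρ x) (hρm : Continuous ρ) {m : ℕ} {a p : ℝ}
    {D : (Fin d → ℕ) → Ed d → ℝ}
    (hD : ∀ α ∈ multiIdx d m, AEStronglyMeasurable (D α) (volume.restrict Ω))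
    (h : nint d Ω ρ m a p D ≠ ⊤) :
    ∀ α ∈ multiIdx d m, IntegrableOn (kIntegrand d ρ a p α (D α)) Ω volume := by
  intro α hα
  have hm : AEStronglyMeasurable (kIntegrand d ρ a p α (D α)) (volume.restrict Ω) := by
    have e : kIntegrand d ρ a p α (D α) = fun x => ρ x ^ (((alen d α : ℝ) - a) * p) * |D α x| ^ p :=
      funext (kIntegrand_eq hρ a p α (D α))
    rw [e]
    exact ((hρm.measurable.pow_const _).aemeasurable.mul
      ((hD α hα).aemeasurable.abs.pow_const p)).aestronglyMeasurable
  refine ⟨hm, ?_⟩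
  rw [hasFiniteIntegral_iff_ofReal (Eventually.of_forall fun x => kIntegrand_nonneg hρ _ _ _ _ _),
    ← jint_eq hρ]
  exact lt_of_le_of_lt (jint_le_nint (mem_multiIdx.mp hα)) (lt_top_iff_ne_top.mpr h)

lemma rho_nonneg (d ℓ : ℕ) (x : Ed d) : 0 ≤ rhoModel d ℓ x := by
  rw [rhoModel_eq]; positivity

lemma suff (d ℓ : ℕ) (hd : 2 ≤ d) (m m' : ℕ)
    (a a' p q : ℝ) (hp : 1 ≤ p) (hpq : p ≤ q)
    (h1 : (m' : ℝ) - d / q ≤ (m : ℝ) - d / p) (h2 : a' - d / q ≤ a - d / p) :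
    ∃ c : ℝ, 0 < c ∧ ∀ u : Ed d → ℝ, MemKM d ℓ m a p u →
        MemKM d ℓ m' a' q u ∧ KnormM d ℓ m' a' q u ≤ c * KnormM d ℓ m a p u := by
  have hp0 : 0 < p := by linarith
  have hq0 : 0 < q := by linarith
  have hdq : (d:ℝ) / q ≤ d / p := by gcongr
  have hmm : m' ≤ m := by exact_mod_cast (by linarith : (m' : ℝ) ≤ m)
  obtain ⟨k, rfl⟩ := Nat.exists_eq_add_of_le hmm
  have hσ := goodWeight_model d ℓ
  have hΩ := hσ.isOpen
  have hρ := rho_nonneg d ℓ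
  push_cast at h1
  obtain ⟨C, hC⟩ := hσ.fam hd k hp hpq (by linarith) a m'
  obtain ⟨B1, hB1⟩ := nint_compar hΩ (fun x hx => rho_pos hx) (rho_le d ℓ) (sgm_le d ℓ) m' (a - d / p + d / q) q
  obtain ⟨B2, hB2⟩ := nint_compar hΩ hσ.pos (sgm_le d ℓ) (rho_le d ℓ) (m' + k) a p
  have hqp : 0 ≤ q / p := by positivity
  set M : ℝ≥0 := B1 * (C * B2 ^ (q / p)) with hM
  have hMD : ∀ D, WFam d (ModelDomain d ℓ) (m' + k) D → nint d (ModelDomain d ℓ) (rhoModel d ℓ) m' a' q D ≤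
      M * nint d (ModelDomain d ℓ) (rhoModel d ℓ) (m' + k) a p D ^ (q / p) := by
    intro D hD
    calc _ ≤ nint d (ModelDomain d ℓ) (rhoModel d ℓ) m' (a - d / p + d / q) q D :=
          nint_mono_a hΩ (fun x hx => rho_pos hx) (rho_le_one d ℓ) _ hq0.le (by linarith) _
      _ ≤ B1 * (C * (B2 * nint d (ModelDomain d ℓ) (rhoModel d ℓ) (m' + k) a p D) ^ (q / p)) := by
          refine (hB1 D).trans ?_
          gcongr
          refine (hC D hD).trans ?_
          gcongr
          exact hB2 D
      _ = _ := by
          rw [ENNReal.mul_rpow_of_nonneg _ _ hqp, hM, ENNReal.coe_mul, ENNReal.coe_mul,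
            ENNReal.coe_rpow_of_nonneg _ hqp]
          ring
  refine ⟨(M:ℝ) ^ (1 / q) + 1, by positivity, ?_⟩
  rintro u ⟨D, hD⟩
  have hW := hMD D hD.1.wfam
  have hsub : ∀ α ∈ multiIdx d m', α ∈ multiIdx d (m' + k) := fun α hα => by
    rw [mem_multiIdx] at hα ⊢; omega
  have e1 := nint_eq_sum hρ hD.2
  rw [e1] at hW
  have hS0 : 0 ≤ ∑ α ∈ multiIdx d (m' + k), ∫ x in ModelDomain d ℓ, kIntegrand d (rhoModel d ℓ) a p α (D α) x :=
    Finset.sum_nonneg fun α _ => integral_nonneg fun x => kIntegrand_nonneg hρ _ _ _ _ _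
  have hfin : nint d (ModelDomain d ℓ) (rhoModel d ℓ) m' a' q D ≠ ⊤ := by
    refine ne_top_of_le_ne_top ?_ hW
    exact ENNReal.mul_ne_top ENNReal.coe_ne_top (ENNReal.rpow_ne_top_of_nonneg hqp ENNReal.ofReal_ne_top)
  have hI := integrable_of_nint hρ (rho_cont d ℓ)
    (fun α hα => (hD.1 α (hsub α hα)).2.1.aestronglyMeasurable) hfin
  have hD' : KMemData d (ModelDomain d ℓ) (rhoModel d ℓ) m' a' q u D :=
    ⟨fun α hα => hD.1 α (hsub α hα), hI⟩
  refine ⟨⟨D, hD'⟩, ?_⟩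
  unfold KnormM
  rw [Knorm_eq hΩ hD, Knorm_eq hΩ hD']
  unfold KnormP
  have e2 := nint_eq_sum hρ hI
  rw [e2] at hW
  set S := ∑ α ∈ multiIdx d (m' + k), ∫ x in ModelDomain d ℓ, kIntegrand d (rhoModel d ℓ) a p α (D α) x
  have hS'0 : 0 ≤ ∑ α ∈ multiIdx d m', ∫ x in ModelDomain d ℓ, kIntegrand d (rhoModel d ℓ) a' q α (D α) x :=
    Finset.sum_nonneg fun α _ => integral_nonneg fun x => kIntegrand_nonneg hρ _ _ _ _ _
  set S' := ∑ α ∈ multiIdx d m', ∫ x in ModelDomain d ℓ, kIntegrand d (rhoModel d ℓ) a' q α (D α) x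
  rw [ENNReal.ofReal_rpow_of_nonneg hS0 hqp, ← ENNReal.ofReal_coe_nnreal, ← ENNReal.ofReal_mul (by positivity),
    ENNReal.ofReal_le_ofReal_iff (by positivity)] at hW
  calc S' ^ (1 / q) ≤ ((M:ℝ) * S ^ (q / p)) ^ (1 / q) := by gcongr
    _ = (M:ℝ) ^ (1 / q) * S ^ (1 / p) := by
        rw [Real.mul_rpow (by positivity) (by positivity), ← Real.rpow_mul hS0]
        congr 2; field_simp
    _ ≤ _ := by
        gcongr
        linarith
end

section

variable {d : ℕ} {Ω : Set (Ed d)}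

lemma midx_induction {P : (Fin d → ℕ) → Prop} (h0 : P 0) (hs : ∀ α i, P α → P (α + Pi.single i 1)) :
    ∀ α, P α := by
  have key : ∀ n α, alen d α = n → P α := by
    intro n
    induction n with
    | zero =>
      intro α hα
      have : α = 0 := by
        ext i
        have h := Finset.single_le_sum (f := α) (fun j _ => Nat.zero_le _) (Finset.mem_univ i)
        unfold alen at hα
        simp only [Pi.zero_apply]
        omega
      rw [this]; exact h0
    | succ n ih =>
      intro α hα
      obtain ⟨i, hi⟩ : ∃ i, α i ≠ 0 := by
        by_contra hcon
        push Not at hcon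
        simp [alen, hcon] at hα
      have e : (α - Pi.single i 1) + Pi.single i 1 = α := by
        ext j
        by_cases hj : j = i
        · subst hj; simp; omega
        · simp [hj]
      rw [← e]
      apply hs
      apply ih
      have := alen_add_single (α - Pi.single i 1) i
      rw [e] at this
      omega
  exact fun α => key _ α rfl

lemma pderivA_succ {f : Ed d → ℝ} (hf : ContDiff ℝ (⊤ : ℕ∞) f) (α : Fin d → ℕ) (i : Fin d) :
    pderivA d (α + Pi.single i 1) f = pderivI d i (pderivA d α f) := by
  rw [pderivA_add_single hf, pderivA_comm hf]

lemma tsupport_pderivA {f : Ed d → ℝ} (hf : ContDiff ℝ (⊤ : ℕ∞) f) (α : Fin d → ℕ) :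
    tsupport (pderivA d α f) ⊆ tsupport f := by
  induction α using midx_induction with
  | h0 => rw [pderivA_zero]
  | hs α i ih => rw [pderivA_succ hf]; exact (tsupport_pderivI i).trans ih

lemma ibp_one {f φ : Ed d → ℝ} (hf : ContDiff ℝ (⊤ : ℕ∞) f) (hφ : ContDiff ℝ (⊤ : ℕ∞) φ)
    (hc : HasCompactSupport φ) (i : Fin d) :
    ∫ x, f x * pderivI d i φ x = - ∫ x, pderivI d i f x * φ x := by
  have hc' : HasCompactSupport (pderivI d i φ) :=
    hc.of_isClosed_subset (isClosed_tsupport _) (tsupport_pderivI i)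
  have := integral_mul_fderiv_eq_neg_fderiv_mul_of_integrable (μ := volume) (f := f) (g := φ)
    (v := EuclideanSpace.single i 1) ?_ ?_ ?_ ?_ ?_
  · exact this
  · exact ((smooth_pderivI hf i).continuous.mul hφ.continuous).integrable_of_hasCompactSupport hc.mul_left
  · exact (hf.continuous.mul (smooth_pderivI hφ i).continuous).integrable_of_hasCompactSupport hc'.mul_left
  · exact (hf.continuous.mul hφ.continuous).integrable_of_hasCompactSupport hc.mul_left
  · exact fun x _ => hf.differentiable (by simp) x
  · exact fun x _ => hφ.differentiable (by simp) x

lemma ibp_all {f : Ed d → ℝ} (hf : ContDiff ℝ (⊤ : ℕ∞) f) (α : Fin d → ℕ) :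
    ∀ φ : Ed d → ℝ, ContDiff ℝ (⊤ : ℕ∞) φ → HasCompactSupport φ →
    ∫ x, f x * pderivA d α φ x = (-1 : ℝ) ^ (alen d α) * ∫ x, pderivA d α f x * φ x := by
  induction α using midx_induction with
  | h0 => intro φ _ _; simp [pderivA_zero, alen]
  | hs α i ih =>
    intro φ hφ hc
    have hc' : HasCompactSupport (pderivI d i φ) :=
      hc.of_isClosed_subset (isClosed_tsupport _) (tsupport_pderivI i)
    rw [pderivA_add_single hφ, ih _ (smooth_pderivI hφ i) hc', ibp_one (smooth_pderivA hf α) hφ hc,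
      pderivA_succ hf, alen_add_single, pow_succ]
    ring

lemma classical_weak {f : Ed d → ℝ} (hf : ContDiff ℝ (⊤ : ℕ∞) f) (α : Fin d → ℕ) :
    HasWeakDerivOn d Ω α f (pderivA d α f) := by
  refine ⟨hf.continuous.locallyIntegrable.locallyIntegrableOn Ω,
    (smooth_pderivA hf α).continuous.locallyIntegrable.locallyIntegrableOn Ω, fun φ hφ => ?_⟩
  rw [setIntegral_eq_integral_of_forall_compl_eq_zero, setIntegral_eq_integral_of_forall_compl_eq_zero]
  · exact ibp_all hf α φ hφ.1 hφ.2.1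
  · intro x hx
    rw [image_eq_zero_of_notMem_tsupport fun h => hx (hφ.2.2 h), mul_zero]
  · intro x hx
    rw [image_eq_zero_of_notMem_tsupport fun h => hx (hφ.2.2 (tsupport_pderivA hφ.1 α h)), mul_zero]

lemma pderivA_ne_zero {f : Ed d → ℝ} (hf : ContDiff ℝ (⊤ : ℕ∞) f) (hc : HasCompactSupport f)
    (hne : f ≠ 0) (α : Fin d → ℕ) : pderivA d α f ≠ 0 := by
  induction α using midx_induction with
  | h0 => rw [pderivA_zero]; exact hne
  | hs α i ih =>
    rw [pderivA_succ hf]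
    intro h0
    apply ih
    set g := pderivA d α f with hg
    have hgs : ContDiff ℝ (⊤ : ℕ∞) g := smooth_pderivA hf α
    have hgc : HasCompactSupport g := hc.of_isClosed_subset (isClosed_tsupport _) (tsupport_pderivA hf α)
    obtain ⟨R, hR⟩ := hgc.isBounded.subset_closedBall 0
    ext x
    have hder : ∀ t : ℝ, HasDerivAt (fun t : ℝ => g (x + t • EuclideanSpace.single i 1)) 0 t := by
      intro t
      have h1 : HasFDerivAt g (fderiv ℝ g (x + t • EuclideanSpace.single i 1)) (x + t • EuclideanSpace.single i 1) :=
        (hgs.differentiable (by simp) _).hasFDerivAt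
      have h2 : HasDerivAt (fun t : ℝ => x + t • EuclideanSpace.single i (1:ℝ)) (EuclideanSpace.single i 1) t := by
        simpa using ((hasDerivAt_id t).smul_const (EuclideanSpace.single i (1:ℝ))).const_add x
      have h3 := h1.comp_hasDerivAt t h2
      have h4 : fderiv ℝ g (x + t • EuclideanSpace.single i 1) (EuclideanSpace.single i 1) = 0 :=
        congrFun h0 (x + t • EuclideanSpace.single i 1)
      rw [h4] at h3
      exact h3
    have hconst := is_const_of_deriv_eq_zero (f := fun t : ℝ => g (x + t • EuclideanSpace.single i 1))
      (fun t => (hder t).differentiableAt) (fun t => (hder t).deriv) 0 (|R| + ‖x‖ + 1)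
    simp only [zero_smul, add_zero] at hconst
    rw [hconst]
    apply image_eq_zero_of_notMem_tsupport
    intro hmem
    have hb := hR hmem
    rw [mem_closedBall, dist_zero_right] at hb
    have h5 : ‖(|R| + ‖x‖ + 1) • EuclideanSpace.single i (1:ℝ)‖ = |R| + ‖x‖ + 1 := by
      rw [norm_smul]; simp; positivity
    have h6 := norm_sub_le (x + (|R| + ‖x‖ + 1) • EuclideanSpace.single i (1:ℝ)) x
    rw [add_sub_cancel_left, h5] at h6
    have := le_abs_self R
    linarith

/-- Rescaled function. -/
def scl (d : ℕ) (ε : ℝ) (y : Ed d) (f : Ed d → ℝ) : Ed d → ℝ := fun x => f (ε⁻¹ • (x - y))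

lemma smooth_scl {f : Ed d → ℝ} (hf : ContDiff ℝ (⊤ : ℕ∞) f) (ε : ℝ) (y : Ed d) :
    ContDiff ℝ (⊤ : ℕ∞) (scl d ε y f) :=
  hf.comp ((contDiff_id.sub contDiff_const).const_smul _)

lemma pderivI_scl {f : Ed d → ℝ} (hf : ContDiff ℝ (⊤ : ℕ∞) f) (ε : ℝ) (y : Ed d) (k : ℝ) (i : Fin d) :
    pderivI d i (fun x => k * scl d ε y f x) = fun x => k * ε⁻¹ * scl d ε y (pderivI d i f) x := by
  ext x
  have h1 : HasFDerivAt (fun x : Ed d => ε⁻¹ • (x - y)) (ε⁻¹ • ContinuousLinearMap.id ℝ (Ed d)) x :=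
    ((hasFDerivAt_id (𝕜 := ℝ) x).sub_const y).const_smul ε⁻¹
  have h2 : HasFDerivAt f (fderiv ℝ f (ε⁻¹ • (x - y))) (ε⁻¹ • (x - y)) :=
    (hf.differentiable (by simp) _).hasFDerivAt
  have h3 : HasFDerivAt (fun x => k * scl d ε y f x) _ x := (h2.comp x h1).const_mul k
  unfold pderivI
  rw [h3.fderiv]
  simp [scl]
  ring

lemma pderivA_scl {f : Ed d → ℝ} (hf : ContDiff ℝ (⊤ : ℕ∞) f) (ε : ℝ) (y : Ed d) (α : Fin d → ℕ) :
    pderivA d α (scl d ε y f) = fun x => ε⁻¹ ^ alen d α * scl d ε y (pderivA d α f) x := by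
  induction α using midx_induction with
  | h0 => ext x; simp [pderivA_zero, alen]
  | hs α i ih =>
    rw [pderivA_succ (smooth_scl hf ε y), ih, pderivI_scl (smooth_pderivA hf α), pderivA_succ hf,
      alen_add_single]
    ext x; rw [pow_succ]
end

section

variable {d : ℕ} {Ω : Set (Ed d)}

lemma integral_scl {f : Ed d → ℝ} {ε : ℝ} (hε : 0 < ε) (y : Ed d) :
    ∫ x, scl d ε y f x = ε ^ (d : ℝ) * ∫ x, f x := by
  unfold scl
  rw [integral_sub_right_eq_self (fun x => f (ε⁻¹ • x)) y, Measure.integral_comp_smul]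
  rw [finrank_euclideanSpace_fin, smul_eq_mul, Real.rpow_natCast, inv_pow, inv_inv, abs_of_pos (by positivity)]

lemma kI_bounds (hΩ : IsOpen Ω) {ρ : Ed d → ℝ} (hρ : ∀ x, 0 ≤ ρ x) (hρc : Continuous ρ) {s ε a p : ℝ} (hs : 0 < s)
    (hε : 0 < ε) (hp : 1 ≤ p) (α : Fin d → ℕ) (y : Ed d)
    (hy : ∀ x, ‖x - y‖ ≤ ε → x ∈ Ω ∧ s ≤ 2 * ρ x ∧ ρ x ≤ 2 * s)
    {f v : Ed d → ℝ} (hf : Continuous f) (hfc : HasCompactSupport f) (hf1 : ∀ x, 1 < ‖x‖ → f x = 0)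
    (hv : v = fun x => ε⁻¹ ^ alen d α * scl d ε y f x) :
    IntegrableOn (kIntegrand d ρ a p α v) Ω volume ∧
    (∫ x in Ω, kIntegrand d ρ a p α v x) ≤ 2 ^ |((alen d α : ℝ) - a) * p| *
      ((s ^ (((alen d α : ℝ) - a) * p) * ε ^ (-(alen d α : ℝ) * p)) * ε ^ (d:ℝ) * ∫ x, |f x| ^ p) ∧
    (s ^ (((alen d α : ℝ) - a) * p) * ε ^ (-(alen d α : ℝ) * p)) * ε ^ (d:ℝ) * (∫ x, |f x| ^ p) ≤
      2 ^ |((alen d α : ℝ) - a) * p| * ∫ x in Ω, kIntegrand d ρ a p α v x := by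
  have hp0 : 0 < p := by linarith
  set b := ((alen d α : ℝ) - a) * p with hb
  set n := alen d α with hn
  set W : ℝ := s ^ b * ε ^ (-(n:ℝ) * p) with hW
  have hW0 : 0 < W := by positivity
  have hfp : Continuous fun x => |f x| ^ p := hf.abs.rpow_const fun _ => Or.inr hp0.le
  have hfpc : HasCompactSupport fun x => |f x| ^ p :=
    hfc.comp_left (g := fun t : ℝ => |t| ^ p) (by simp [hp0.ne'])
  set F : Ed d → ℝ := scl d ε y (fun x => |f x| ^ p) with hF
  have hFint : Integrable F volume := by
    have h1 : Integrable (fun x => |f x| ^ p) volume := hfp.integrable_of_hasCompactSupport hfpc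
    exact (h1.comp_smul (inv_ne_zero hε.ne')).comp_sub_right y
  have hF0 : ∀ x, 0 ≤ F x := fun x => by simp only [hF, scl]; positivity
  have hFz : ∀ x, ¬ ‖x - y‖ ≤ ε → F x = 0 := by
    intro x hx
    simp only [hF, scl]
    rw [hf1, abs_zero, Real.zero_rpow hp0.ne']
    rw [norm_smul, norm_inv, Real.norm_of_nonneg hε.le, inv_mul_eq_div, one_lt_div hε]
    exact not_le.mp hx
  have hk : ∀ x, kIntegrand d ρ a p α v x = ρ x ^ b * (ε ^ (-(n:ℝ) * p) * F x) := by
    intro x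
    rw [kIntegrand_eq hρ, hv]
    congr 1
    simp only [hF, scl]
    rw [abs_mul, Real.mul_rpow (abs_nonneg _) (abs_nonneg _), abs_of_pos (by positivity)]
    congr 1
    rw [← Real.rpow_natCast, Real.inv_rpow hε.le, ← Real.rpow_neg hε.le, ← Real.rpow_mul hε.le]
  have hup : ∀ x, kIntegrand d ρ a p α v x ≤ 2 ^ |b| * (W * F x) := by
    intro x
    rw [hk]
    by_cases hx : ‖x - y‖ ≤ ε
    · obtain ⟨h1, h2, h3⟩ := hy x hx
      have := rpow_compar (s := ρ x) (t := s) (by linarith) h3 h2 b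
      calc _ ≤ (2 ^ |b| * s ^ b) * (ε ^ (-(n:ℝ) * p) * F x) := by
            have := hF0 x
            gcongr
        _ = _ := by rw [hW]; ring
    · simp [hFz x hx]
  have hlo : ∀ x, W * F x ≤ 2 ^ |b| * kIntegrand d ρ a p α v x := by
    intro x
    rw [hk]
    by_cases hx : ‖x - y‖ ≤ ε
    · obtain ⟨h1, h2, h3⟩ := hy x hx
      have := rpow_compar (s := s) (t := ρ x) hs h2 h3 b
      calc W * F x = s ^ b * (ε ^ (-(n:ℝ) * p) * F x) := by rw [hW]; ring
        _ ≤ (2 ^ |b| * ρ x ^ b) * (ε ^ (-(n:ℝ) * p) * F x) := by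
            have := hF0 x
            gcongr
        _ = _ := by ring
    · simp [hFz x hx]
  have hm : AEStronglyMeasurable (kIntegrand d ρ a p α v) (volume.restrict Ω) := by
    rw [funext hk]
    exact ((hρc.measurable.pow_const b).aemeasurable.mul
      (hFint.aestronglyMeasurable.aemeasurable.restrict.const_mul _)).aestronglyMeasurable
  have hIntg : IntegrableOn (kIntegrand d ρ a p α v) Ω volume := by
    refine Integrable.mono' ((hFint.const_mul W).const_mul (2 ^ |b|)).integrableOn hm
      (Eventually.of_forall fun x => ?_)
    rw [Real.norm_of_nonneg (kIntegrand_nonneg hρ _ _ _ _ _)]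
    exact hup x
  have hFΩ : ∫ x in Ω, F x = ε ^ (d:ℝ) * ∫ x, |f x| ^ p := by
    rw [setIntegral_eq_integral_of_forall_compl_eq_zero, hF, integral_scl hε]
    intro x hx
    exact hFz x fun h => hx (hy x h).1
  refine ⟨hIntg, ?_, ?_⟩
  · calc _ ≤ ∫ x in Ω, 2 ^ |b| * (W * F x) :=
          integral_mono hIntg ((hFint.const_mul W).const_mul (2 ^ |b|)).integrableOn hup
      _ = _ := by rw [integral_const_mul, integral_const_mul, hFΩ]; ring
  · calc _ = ∫ x in Ω, W * F x := by rw [integral_const_mul, hFΩ]; ring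
      _ ≤ ∫ x in Ω, 2 ^ |b| * kIntegrand d ρ a p α v x :=
          integral_mono (hFint.const_mul W).integrableOn (hIntg.const_mul _) hlo
      _ = _ := by rw [integral_const_mul]

lemma exponent_le {K1 K2 e1 e2 : ℝ} (hK : 0 < K1)
    (h : ∀ ε : ℝ, 0 < ε → ε ≤ 1 / 3 → K1 * ε ^ e1 ≤ K2 * ε ^ e2) : e2 ≤ e1 := by
  by_contra hlt
  push Not at hlt
  have ht : Tendsto (fun ε : ℝ => K2 * ε ^ (e2 - e1)) (𝓝[>] 0) (𝓝 (K2 * 0)) := by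
    apply Tendsto.const_mul
    have : ContinuousAt (fun ε : ℝ => ε ^ (e2 - e1)) 0 :=
      Real.continuousAt_rpow_const _ _ (Or.inr (by linarith))
    have h2 := this.tendsto
    rw [Real.zero_rpow (by linarith)] at h2
    exact h2.mono_left nhdsWithin_le_nhds
  have hle : K1 ≤ K2 * 0 := by
    refine ge_of_tendsto ht ?_
    filter_upwards [Ioc_mem_nhdsGT (show (0:ℝ) < 1 / 3 by norm_num)] with ε hε
    have h1 := h ε hε.1 hε.2
    have hpos : 0 < ε ^ e1 := Real.rpow_pos_of_pos hε.1 _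
    rw [Real.rpow_sub hε.1, ← mul_div_assoc, le_div_iff₀ hpos]
    exact h1
  linarith

/-- The embedding property. -/
def Emb (d ℓ m m' : ℕ) (a a' p q c : ℝ) : Prop :=
  ∀ u : Ed d → ℝ, MemKM d ℓ m a p u →
        MemKM d ℓ m' a' q u ∧ KnormM d ℓ m' a' q u ≤ c * KnormM d ℓ m a p u

lemma nec_core (d ℓ : ℕ) (m m' : ℕ) (a a' p q c b b' : ℝ) (hp : 1 ≤ p) (hpq : p ≤ q)
    (hemb : Emb d ℓ m m' a a' p q c) (hc : 0 < c) (y : ℝ → Ed d) (s : ℝ → ℝ)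
    (hs : ∀ ε : ℝ, 0 < ε → ε ≤ 1 / 3 → 0 < s ε)
    (hy : ∀ ε : ℝ, 0 < ε → ε ≤ 1 / 3 → ∀ x, ‖x - y ε‖ ≤ ε →
      x ∈ ModelDomain d ℓ ∧ s ε ≤ 2 * rhoModel d ℓ x ∧ rhoModel d ℓ x ≤ 2 * s ε)
    (A : (Fin d → ℕ) → ℝ) (hA : ∀ α, 0 ≤ A α) (β : Fin d → ℕ) (hβ : alen d β ≤ m') (κ : ℝ) (hκ : 0 < κ)
    (hup : ∀ ε : ℝ, 0 < ε → ε ≤ 1 / 3 → ∀ α, alen d α ≤ m →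
      s ε ^ (((alen d α : ℝ) - a) * p) * ε ^ (-(alen d α : ℝ) * p) ≤ A α * ε ^ (-b * p))
    (hlo : ∀ ε : ℝ, 0 < ε → ε ≤ 1 / 3 →
      κ * ε ^ (-b' * q) ≤ s ε ^ (((alen d β : ℝ) - a') * q) * ε ^ (-(alen d β : ℝ) * q)) :
    b' - d / q ≤ b - d / p := by
  have hp0 : 0 < p := by linarith
  have hq0 : 0 < q := by linarith
  have hΩ := (goodWeight_model d ℓ).isOpen
  have hρ := rho_nonneg d ℓ
  let ψ : ContDiffBump (0 : Ed d) := ⟨1 / 2, 1, by norm_num, by norm_num⟩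
  have hψ : ContDiff ℝ (⊤ : ℕ∞) ψ := ψ.contDiff
  have hψc : HasCompactSupport ψ := ψ.hasCompactSupport
  have hψne : (ψ : Ed d → ℝ) ≠ 0 := by
    intro h
    have h1 : ψ 0 = 1 := ψ.one_of_mem_closedBall (by simp [ψ])
    rw [h] at h1
    simp at h1
  have hfc : ∀ α, HasCompactSupport (pderivA d α ψ) := fun α =>
    hψc.of_isClosed_subset (isClosed_tsupport _) (tsupport_pderivA hψ α)
  have hf1 : ∀ α x, 1 < ‖x‖ → pderivA d α ψ x = 0 := by
    intro α x hx
    apply image_eq_zero_of_notMem_tsupport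
    intro h
    have h2 := tsupport_pderivA hψ α h
    rw [ψ.tsupport_eq, mem_closedBall, dist_zero_right] at h2
    have : ψ.rOut = 1 := rfl
    linarith
  set I : (Fin d → ℕ) → ℝ → ℝ := fun α r => ∫ x, |pderivA d α ψ x| ^ r with hI
  have hI0 : ∀ α r, 0 ≤ I α r := fun α r => integral_nonneg fun x => by positivity
  have hIβ : 0 < I β q := by
    have hne := pderivA_ne_zero hψ hψc hψne β
    obtain ⟨x, hx⟩ := Function.ne_iff.mp hne
    refine Continuous.integral_pos_of_hasCompactSupport_nonneg_nonzero (x := x)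
      ((smooth_pderivA hψ β).continuous.abs.rpow_const fun _ => Or.inr hq0.le)
      ((hfc β).comp_left (g := fun t : ℝ => |t| ^ q) (by simp [hq0.ne'])) (fun x => by positivity) ?_
    have : 0 < |pderivA d β ψ x| := abs_pos.mpr hx
    positivity
  set A' : ℝ := ∑ α ∈ multiIdx d m, 2 ^ |((alen d α : ℝ) - a) * p| * (A α * I α p) with hA'
  have hA'0 : 0 ≤ A' := Finset.sum_nonneg fun α _ => by
    have := hA α; have := hI0 α p; positivity
  set κ' : ℝ := (2 ^ |((alen d β : ℝ) - a') * q|)⁻¹ * (κ * I β q) with hκ'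
  have hκ'0 : 0 < κ' := by positivity
  have main : ∀ ε : ℝ, 0 < ε → ε ≤ 1 / 3 →
      κ' ^ (1 / q) * ε ^ (-b' + d / q) ≤ (c * A' ^ (1 / p)) * ε ^ (-b + d / p) := by
    intro ε hε hε3
    set u := scl d ε (y ε) ψ with hu
    have hus : ContDiff ℝ (⊤ : ℕ∞) u := smooth_scl hψ ε (y ε)
    have B1 := fun α => kI_bounds hΩ hρ (rho_cont d ℓ) (a := a) (hs ε hε hε3) hε hp α (y ε) (hy ε hε hε3)
      (smooth_pderivA hψ α).continuous (hfc α) (hf1 α) (pderivA_scl hψ ε (y ε) α)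
    have B2 := fun α => kI_bounds hΩ hρ (rho_cont d ℓ) (a := a') (hs ε hε hε3) hε (hp.trans hpq) α (y ε) (hy ε hε hε3)
      (smooth_pderivA hψ α).continuous (hfc α) (hf1 α) (pderivA_scl hψ ε (y ε) α)
    have hD1 : KMemData d (ModelDomain d ℓ) (rhoModel d ℓ) m a p u (fun α => pderivA d α u) :=
      ⟨fun α _ => classical_weak hus α, fun α _ => (B1 α).1⟩
    have hD2 : KMemData d (ModelDomain d ℓ) (rhoModel d ℓ) m' a' q u (fun α => pderivA d α u) :=
      ⟨fun α _ => classical_weak hus α, fun α _ => (B2 α).1⟩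
    have hle := (hemb u ⟨_, hD1⟩).2
    unfold KnormM at hle
    rw [Knorm_eq hΩ hD1, Knorm_eq hΩ hD2] at hle
    unfold KnormP at hle
    have hlow : κ' * (ε ^ (-b' * q) * ε ^ (d:ℝ)) ≤
        ∑ α ∈ multiIdx d m', ∫ x in ModelDomain d ℓ, kIntegrand d (rhoModel d ℓ) a' q α (pderivA d α u) x := by
      refine le_trans ?_ (Finset.single_le_sum (f := fun α => ∫ x in ModelDomain d ℓ,
        kIntegrand d (rhoModel d ℓ) a' q α (pderivA d α u) x)
        (fun α _ => integral_nonneg fun x => kIntegrand_nonneg hρ _ _ _ _ _) (mem_multiIdx.mpr hβ))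
      have h1 := (B2 β).2.2
      have h2 : κ * ε ^ (-b' * q) * ε ^ (d:ℝ) * I β q ≤
          (s ε ^ (((alen d β : ℝ) - a') * q) * ε ^ (-(alen d β : ℝ) * q)) * ε ^ (d:ℝ) * I β q := by
        have := hlo ε hε hε3
        gcongr
      have h3 := h2.trans h1
      rw [hκ', mul_assoc, inv_mul_le_iff₀ (by positivity)]
      refine le_trans (le_of_eq ?_) h3
      ring
    have hupp : (∑ α ∈ multiIdx d m, ∫ x in ModelDomain d ℓ,
        kIntegrand d (rhoModel d ℓ) a p α (pderivA d α u) x) ≤ A' * (ε ^ (-b * p) * ε ^ (d:ℝ)) := by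
      rw [hA', Finset.sum_mul]
      refine Finset.sum_le_sum fun α hα => ?_
      refine (B1 α).2.1.trans ?_
      have h1 := hup ε hε hε3 α (mem_multiIdx.mp hα)
      have h2 := hI0 α p
      calc _ ≤ 2 ^ |((alen d α : ℝ) - a) * p| * ((A α * ε ^ (-b * p)) * ε ^ (d:ℝ) * I α p) := by
            gcongr
        _ = _ := by ring
    have hS0 : 0 ≤ ∑ α ∈ multiIdx d m, ∫ x in ModelDomain d ℓ,
        kIntegrand d (rhoModel d ℓ) a p α (pderivA d α u) x :=
      Finset.sum_nonneg fun α _ => integral_nonneg fun x => kIntegrand_nonneg hρ _ _ _ _ _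
    have e1 : κ' ^ (1 / q) * ε ^ (-b' + d / q) = (κ' * (ε ^ (-b' * q) * ε ^ (d:ℝ))) ^ (1 / q) := by
      rw [← Real.rpow_add hε, Real.mul_rpow hκ'0.le (by positivity), ← Real.rpow_mul hε.le]
      congr 2; field_simp
    have e2 : (c * A' ^ (1 / p)) * ε ^ (-b + d / p) = c * (A' * (ε ^ (-b * p) * ε ^ (d:ℝ))) ^ (1 / p) := by
      rw [← Real.rpow_add hε, Real.mul_rpow hA'0 (by positivity), ← Real.rpow_mul hε.le, mul_assoc]
      congr 3; field_simp
    rw [e1, e2]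
    refine le_trans ?_ (hle.trans ?_)
    · exact Real.rpow_le_rpow (by positivity) hlow (by positivity)
    · exact mul_le_mul_of_nonneg_left (Real.rpow_le_rpow hS0 hupp (by positivity)) hc.le
  have := exponent_le (Real.rpow_pos_of_pos hκ'0 _) main
  linarith

lemma prj_single {d ℓ : ℕ} (i : Fin d) (hi : (i : ℕ) < d - ℓ) (t : ℝ) :
    prj d ℓ (EuclideanSpace.single i t) = EuclideanSpace.single i t := by
  ext j
  rw [prj_apply]
  split_ifs with h
  · rfl
  · have : j ≠ i := by rintro rfl; exact h hi
    simp [this]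

lemma prj_near {d ℓ : ℕ} (i : Fin d) (hi : (i : ℕ) < d - ℓ) {t ε : ℝ} (ht : 0 ≤ t) {x : Ed d}
    (hx : ‖x - EuclideanSpace.single i t‖ ≤ ε) : t - ε ≤ ‖prj d ℓ x‖ ∧ ‖prj d ℓ x‖ ≤ t + ε := by
  have h1 := (prj_lip d ℓ).dist_le_mul x (EuclideanSpace.single i t)
  rw [NNReal.coe_one, one_mul, Real.dist_eq, dist_eq_norm, prj_single i hi] at h1
  have h2 : ‖EuclideanSpace.single i t‖ = t := by simp [abs_of_nonneg ht]
  rw [h2] at h1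
  have := abs_le.mp (h1.trans hx)
  constructor <;> linarith [this.1, this.2]

lemma nec (d ℓ : ℕ) (hl : ℓ < d) (m m' : ℕ) (a a' p q c : ℝ) (hp : 1 ≤ p) (hpq : p ≤ q)
    (hemb : Emb d ℓ m m' a a' p q c) (hc : 0 < c) :
    (m' : ℝ) - d / q ≤ (m : ℝ) - d / p ∧ a' - d / q ≤ a - d / p := by
  have hp0 : 0 < p := by linarith
  have hq0 : 0 < q := by linarith
  let i : Fin d := ⟨0, by omega⟩
  have hi : (i : ℕ) < d - ℓ := by simp [i]; omega
  constructor
  · refine nec_core d ℓ m m' a a' p q c m m' hp hpq hemb hc (fun _ => EuclideanSpace.single i 3) (fun _ => 1)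
      (fun _ _ _ => one_pos) ?_ (fun _ => 1) (fun _ => zero_le_one) (Pi.single i m') ?_ 1 one_pos ?_ ?_
    · intro ε hε hε3 x hx
      obtain ⟨h1, h2⟩ := prj_near i hi (by norm_num) hx
      have h3 : rhoModel d ℓ x = 1 := by
        rw [rhoModel_eq]; exact min_eq_left (by linarith)
      refine ⟨?_, by rw [h3]; norm_num, by rw [h3]; norm_num⟩
      rw [mem_model_iff, ← norm_pos_iff]
      linarith
    · simp [alen]
    · intro ε hε hε3 α hα
      rw [Real.one_rpow, one_mul, one_mul]
      apply Real.rpow_le_rpow_of_exponent_ge hε (by linarith)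
      have : (alen d α : ℝ) ≤ m := by exact_mod_cast hα
      nlinarith
    · intro ε hε hε3
      have : alen d (Pi.single i m') = m' := by simp [alen]
      rw [Real.one_rpow, this]
  · refine nec_core d ℓ m m' a a' p q c a a' hp hpq hemb hc (fun ε => EuclideanSpace.single i (2 * ε)) (fun ε => 2 * ε)
      (fun ε hε _ => by positivity) ?_ (fun α => 2 ^ (((alen d α : ℝ) - a) * p)) (fun _ => by positivity) 0 ?_
      (2 ^ (-a' * q)) (by positivity) ?_ ?_
    · intro ε hε hε3 x hx
      obtain ⟨h1, h2⟩ := prj_near i hi (by linarith) hx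
      have h3 : rhoModel d ℓ x = ‖prj d ℓ x‖ := by
        rw [rhoModel_eq]; exact min_eq_right (by linarith)
      refine ⟨?_, by rw [h3]; linarith, by rw [h3]; linarith⟩
      rw [mem_model_iff, ← norm_pos_iff]
      linarith
    · simp [alen]
    · intro ε hε hε3 α hα
      rw [Real.mul_rpow (by norm_num) hε.le, mul_assoc, ← Real.rpow_add hε]
      apply le_of_eq
      congr 2; ring
    · intro ε hε hε3
      have : alen d (0 : Fin d → ℕ) = 0 := by simp [alen]
      rw [this, Real.mul_rpow (by norm_num) hε.le, mul_assoc, ← Real.rpow_add hε]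
      apply le_of_eq
      push_cast
      congr 2 <;> ring
end

/-- Continuous embeddings of Kondratiev spaces in the model case:
`𝒦^m_{a,p}(ℝ^d, ℝ^ℓ_*) ↪ 𝒦^{m'}_{a',q}(ℝ^d, ℝ^ℓ_*)` if and only if
`m - d/p ≥ m' - d/q` and `a - d/p ≥ a' - d/q`. -/
theorem statement4 (d ℓ : ℕ) (hd : 2 ≤ d) (hl : ℓ < d) (m m' : ℕ) (hm : 1 ≤ m)
    (a a' p q : ℝ) (hp : 1 ≤ p) (hpq : p ≤ q) :
    (∃ c : ℝ, 0 < c ∧ ∀ u : Ed d → ℝ, MemKM d ℓ m a p u →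
        MemKM d ℓ m' a' q u ∧ KnormM d ℓ m' a' q u ≤ c * KnormM d ℓ m a p u) ↔
      ((m' : ℝ) - d / q ≤ (m : ℝ) - d / p ∧ a' - d / q ≤ a - d / p) := by
  constructor
  · rintro ⟨c, hc, h⟩
    exact nec d ℓ hl m m' a a' p q c hp hpq h hc
  · rintro ⟨h1, h2⟩
    exact suff d ℓ hd m m' a a' p q hp hpq h1 h2

end
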